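/- arXiv:1609.08679 — 6 statements merged into one kernel-verified Lean document; each statement's English description precedes it below -/
import Mathlib

section
/- Let p ≥ 3 be a natural number and define c, d, F₁₁, F₁₂ as in the context. Set J₁(t) := (2π/p)·∑_{m=1}^∞ c(m)d(m)e^{−2m²t} + (π/2)·( 2·∑_{m=1}^∞ ∑_{l=1}^∞ F₁₁(m,l;t) + ∑_{m=1}^∞ ∑_{l=1}^∞ F₁₂(m,l;t) ). Then there exists a constant C₁ > 0 such that J₁(t) ≥ C₁·e^{−6t} for all t ≥ 0. -/
noncomputable def c (p k : ℕ) : ℝ :=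
  if k = p then 1 / (p : ℝ)
  else (2 * (p : ℝ)^2 * Real.sin (Real.pi * k / p)) /
       (Real.pi * (k : ℝ) * ((p : ℝ)^2 - (k : ℝ)^2))

noncomputable def d (p k : ℕ) : ℝ :=
  if k = p ∨ k = 2 * p then 1 / (p : ℝ)
  else (6 * (p : ℝ)^2 * (k : ℝ) * Real.sin (Real.pi * k / p)) /
       (Real.pi * ((p : ℝ)^2 - (k : ℝ)^2) * (4 * (p : ℝ)^2 - (k : ℝ)^2))

noncomputable def F11 (p m l : ℕ) (t : ℝ) : ℝ :=
  c p m * d p l * c p (m + l) *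
    Real.exp (-2 * ((m : ℝ)^2 + (l : ℝ)^2 + (m : ℝ) * (l : ℝ)) * t)

noncomputable def F12 (p m l : ℕ) (t : ℝ) : ℝ :=
  c p m * c p l * d p (m + l) *
    Real.exp (-2 * ((m : ℝ)^2 + (l : ℝ)^2 + (m : ℝ) * (l : ℝ)) * t)

open Real Set Filter Topology

/-- `f x t` solves the heat equation for `t > 0` and is continuous up to `t = 0`. -/
structure IsHeatSolution (f : ℝ → ℝ → ℝ) : Prop where
  continuousOn : ContinuousOn (fun q : ℝ × ℝ => f q.1 q.2) {q | 0 ≤ q.2}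
  exists_deriv : ∃ fx fxx : ℝ → ℝ → ℝ, ∀ x t, 0 < t →
    HasDerivAt (fun y => f y t) (fx x t) x ∧ HasDerivAt (fun y => fx y t) (fxx x t) x ∧
      HasDerivAt (f x) (fxx x t) t

theorem IsHeatSolution.sub {f g : ℝ → ℝ → ℝ} (hf : IsHeatSolution f) (hg : IsHeatSolution g) :
    IsHeatSolution (fun x t => f x t - g x t) := by
  obtain ⟨fx, fxx, h⟩ := hf.exists_deriv
  obtain ⟨gx, gxx, k⟩ := hg.exists_deriv
  exact ⟨hf.continuousOn.sub hg.continuousOn, fun x t => fx x t - gx x t,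
    fun x t => fxx x t - gxx x t, fun x t ht =>
    ⟨(h x t ht).1.sub (k x t ht).1, (h x t ht).2.1.sub (k x t ht).2.1,
      (h x t ht).2.2.sub (k x t ht).2.2⟩⟩

theorem IsLocalMin.second_deriv_nonneg {f f' : ℝ → ℝ} {x f'' : ℝ} (h : IsLocalMin f x)
    (hf : ∀ y, HasDerivAt f (f' y) y) (hf' : HasDerivAt f' f'' x) : 0 ≤ f'' := by
  by_contra! hneg
  have hd : deriv f = f' := funext fun y => (hf y).deriv
  have hmax : IsLocalMax f x :=
    isLocalMax_of_deriv_deriv_neg (by rwa [hd, hf'.deriv]) h.deriv_eq_zero (hf x).continuousAt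
  have hconst : f =ᶠ[𝓝 x] fun _ => f x := by
    filter_upwards [h, hmax] with y h1 h2 using le_antisymm h2 h1
  have h0 : deriv (deriv f) x = 0 := by
    rw [hconst.deriv.deriv_eq]
    simp
  rw [hd, hf'.deriv] at h0
  exact hneg.ne h0

theorem HasDerivAt.nonpos_of_forall_le {g : ℝ → ℝ} {g' t : ℝ} (ht : 0 < t)
    (hg : HasDerivAt g g' t) (hmin : ∀ s ∈ Icc 0 t, g t ≤ g s) : g' ≤ 0 := by
  have h1 : Tendsto (slope g t) (𝓝[<] t) (𝓝 g') :=
    hg.tendsto_slope.mono_left (nhdsWithin_mono _ fun s hs => ne_of_lt hs)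
  refine le_of_tendsto h1 ?_
  filter_upwards [self_mem_nhdsWithin, mem_nhdsWithin_of_mem_nhds (lt_mem_nhds ht)] with s hs hs0
  rw [slope_def_field]
  exact div_nonpos_of_nonneg_of_nonpos (sub_nonneg.2 (hmin s ⟨le_of_lt hs0, le_of_lt hs⟩))
    (sub_nonpos.2 (le_of_lt hs))

/-- Weak minimum principle. The boundary hypothesis holds if `f ≥ 0` at the endpoints, and also
for functions that are periodic with period `b - a`. -/
theorem IsHeatSolution.nonneg {f : ℝ → ℝ → ℝ} (hf : IsHeatSolution f) {a b : ℝ}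
    (h0 : ∀ x ∈ Icc a b, 0 ≤ f x 0)
    (hb : ∀ t, 0 < t → ∀ x, x = a ∨ x = b → f x t < 0 → (∀ y ∈ Icc a b, f x t ≤ f y t) →
      IsLocalMin (fun y => f y t) x) :
    ∀ x ∈ Icc a b, ∀ t, 0 ≤ t → 0 ≤ f x t := by
  intro x₁ hx₁ t₁ ht₁
  by_contra! hneg
  obtain ⟨fx, fxx, hd⟩ := hf.exists_deriv
  set ε : ℝ := -f x₁ t₁ / (2 * (t₁ + 1)) with hε
  have hεpos : 0 < ε := div_pos (by linarith) (by linarith)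
  have hsmall : f x₁ t₁ + ε * t₁ < 0 := by
    have : ε * (2 * (t₁ + 1)) = -f x₁ t₁ := by rw [hε]; field_simp
    nlinarith
  have hK : IsCompact (Icc a b ×ˢ Icc (0 : ℝ) t₁) := isCompact_Icc.prod isCompact_Icc
  have hcont : ContinuousOn (fun q : ℝ × ℝ => f q.1 q.2 + ε * q.2) (Icc a b ×ˢ Icc (0 : ℝ) t₁) :=
    (hf.continuousOn.mono fun q hq => hq.2.1).add (by fun_prop)
  obtain ⟨⟨x₀, t₀⟩, ⟨hx₀, ht₀⟩, hmin⟩ := hK.exists_isMinOn ⟨(x₁, t₁), hx₁, ht₁, le_rfl⟩ hcont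
  have hmin' : ∀ x ∈ Icc a b, ∀ t ∈ Icc (0 : ℝ) t₁, f x₀ t₀ + ε * t₀ ≤ f x t + ε * t :=
    fun x hx t ht => hmin (show (x, t) ∈ Icc a b ×ˢ Icc (0 : ℝ) t₁ from ⟨hx, ht⟩)
  have hx₀' : x₀ ∈ Icc a b := hx₀
  have ht₀' : t₀ ∈ Icc 0 t₁ := ht₀
  have hval : f x₀ t₀ < 0 := by
    have := hmin' x₁ hx₁ t₁ ⟨ht₁, le_rfl⟩
    nlinarith [mul_nonneg hεpos.le ht₀'.1]
  have ht₀pos : 0 < t₀ := by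
    rcases ht₀'.1.lt_or_eq with h | h
    · exact h
    · rw [← h] at hval
      exact absurd (h0 x₀ hx₀') (not_le.2 hval)
  have hminx : ∀ y ∈ Icc a b, f x₀ t₀ ≤ f y t₀ := fun y hy => by
    linarith [hmin' y hy t₀ ht₀']
  have hloc : IsLocalMin (fun y => f y t₀) x₀ := by
    by_cases hend : x₀ = a ∨ x₀ = b
    · exact hb t₀ ht₀pos x₀ hend hval hminx
    · push Not at hend
      filter_upwards [Icc_mem_nhds (lt_of_le_of_ne hx₀'.1 hend.1.symm)
        (lt_of_le_of_ne hx₀'.2 hend.2)] with y hy using hminx y hy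
  have hxx : 0 ≤ fxx x₀ t₀ :=
    hloc.second_deriv_nonneg (fun y => (hd y t₀ ht₀pos).1) (hd x₀ t₀ ht₀pos).2.1
  have hder : HasDerivAt (fun t => f x₀ t + ε * t) (fxx x₀ t₀ + ε * 1) t₀ :=
    (hd x₀ t₀ ht₀pos).2.2.add ((hasDerivAt_id t₀).const_mul ε)
  have := hder.nonpos_of_forall_le ht₀pos
    fun s hs => hmin' x₀ hx₀' s ⟨hs.1, hs.2.trans ht₀'.2⟩
  linarith

theorem IsHeatSolution.nonneg_of_boundary {f : ℝ → ℝ → ℝ} (hf : IsHeatSolution f) {a b : ℝ}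
    (h0 : ∀ x ∈ Icc a b, 0 ≤ f x 0) (ha : ∀ t, 0 < t → 0 ≤ f a t) (hb : ∀ t, 0 < t → 0 ≤ f b t) :
    ∀ x ∈ Icc a b, ∀ t, 0 ≤ t → 0 ≤ f x t := by
  refine hf.nonneg h0 ?_
  rintro t ht x (rfl | rfl) hneg _
  · exact absurd (ha t ht) (not_le.2 hneg)
  · exact absurd (hb t ht) (not_le.2 hneg)

theorem hasDerivAt_cos_affine (q θ x : ℝ) :
    HasDerivAt (fun y => cos (q * y + θ)) (q * cos (q * x + (θ + π / 2))) x := by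
  have h : HasDerivAt (fun y => q * y + θ) (q * 1) x :=
    ((hasDerivAt_id x).const_mul q).add_const θ
  convert h.cos using 1
  rw [← add_assoc, cos_add_pi_div_two]
  ring

theorem hasDerivAt_exp_neg_mul (q t : ℝ) :
    HasDerivAt (fun s => exp (-(q * s))) (-q * exp (-(q * t))) t := by
  have h : HasDerivAt (fun s => -(q * s)) (-(q * 1)) t :=
    ((hasDerivAt_id t).const_mul q).neg
  convert h.exp using 1
  ring

/-- A single mode is a solution of the heat equation. -/
theorem isHeatSolution_mode (A q θ : ℝ) :
    IsHeatSolution (fun x t => A * exp (-(q ^ 2 * t)) * cos (q * x + θ)) := by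
  refine ⟨by fun_prop, fun x t => A * exp (-(q ^ 2 * t)) * (q * cos (q * x + (θ + π / 2))),
    fun x t => A * exp (-(q ^ 2 * t)) * (q * (q * cos (q * x + (θ + π / 2 + π / 2)))),
    fun x t _ => ⟨(hasDerivAt_cos_affine q θ x).const_mul _,
      ((hasDerivAt_cos_affine q _ x).const_mul _).const_mul _, ?_⟩⟩
  refine (((hasDerivAt_exp_neg_mul (q ^ 2) t).const_mul A).mul_const
    (cos (q * x + θ))).congr_deriv ?_
  beta_reduce
  rw [add_assoc θ, add_halves, ← add_assoc, cos_add_pi]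
  ring

theorem hasDerivAt_tsum_mul_cos {b : ℕ → ℝ} (hb : Summable b)
    (hb1 : Summable fun k : ℕ => (k : ℝ) * b k) (θ x : ℝ) :
    HasDerivAt (fun y => ∑' k : ℕ, b k * cos (k * y + θ))
      (∑' k : ℕ, (k : ℝ) * b k * cos (k * x + (θ + π / 2))) x := by
  refine hasDerivAt_tsum (F := ℝ) (g := fun (k : ℕ) y => b k * cos (k * y + θ))
    (g' := fun (k : ℕ) y => (k : ℝ) * b k * cos (k * y + (θ + π / 2)))
    (u := fun k : ℕ => |(k : ℝ) * b k|) (y₀ := 0) hb1.abs (fun k y => ?_)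
    (fun k y => ?_) ?_ x
  · exact ((hasDerivAt_cos_affine (k : ℝ) θ y).const_mul (b k)).congr_deriv (by ring)
  · rw [norm_mul, norm_eq_abs, norm_eq_abs]
    exact mul_le_of_le_one_right (abs_nonneg _) (abs_cos_le_one _)
  · refine hb.abs.of_norm_bounded fun k => ?_
    rw [norm_mul, norm_eq_abs, norm_eq_abs]
    exact mul_le_of_le_one_right (abs_nonneg _) (abs_cos_le_one _)

/-- The heat evolution of the trigonometric series `∑ a k * cos (k * x + θ)`. -/
noncomputable def heatSeries (a : ℕ → ℝ) (θ x t : ℝ) : ℝ :=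
  ∑' k : ℕ, a k * exp (-((k : ℝ) ^ 2 * t)) * cos (k * x + θ)

theorem summable_mul_exp_neg {a : ℕ → ℝ} (ha : Summable a) {t : ℝ} (ht : 0 ≤ t) :
    Summable fun k : ℕ => a k * exp (-((k : ℝ) ^ 2 * t)) := by
  refine ha.abs.of_norm_bounded fun k => ?_
  rw [norm_mul, norm_eq_abs, norm_eq_abs, abs_exp]
  exact mul_le_of_le_one_right (abs_nonneg _) (exp_le_one_iff.2 (by simp; positivity))

theorem summable_pow_mul_exp_neg {a : ℕ → ℝ} (ha : Summable a) (n : ℕ) {t : ℝ} (ht : 0 < t) :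
    Summable fun k : ℕ => (k : ℝ) ^ n * |a k| * exp (-((k : ℝ) ^ 2 * t)) := by
  obtain ⟨M, hM⟩ := ha.abs.tendsto_atTop_zero.bddAbove_range
  have hM' : ∀ k, |a k| ≤ M := fun k => hM ⟨k, rfl⟩
  refine Summable.of_nonneg_of_le (fun k => by positivity) (fun k => ?_)
    ((summable_pow_mul_exp_neg_nat_mul n ht).mul_left M)
  have hk : (k : ℝ) ≤ (k : ℝ) ^ 2 := by exact_mod_cast Nat.le_self_pow two_ne_zero k
  have he : exp (-((k : ℝ) ^ 2 * t)) ≤ exp (-t * k) := exp_le_exp.2 (by nlinarith)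
  calc (k : ℝ) ^ n * |a k| * exp (-((k : ℝ) ^ 2 * t)) ≤ (k : ℝ) ^ n * M * exp (-t * k) := by
        gcongr
        · exact mul_nonneg (by positivity) ((abs_nonneg _).trans (hM' k))
        · exact hM' k
    _ = _ := by ring

theorem isHeatSolution_heatSeries {a : ℕ → ℝ} (ha : Summable a) (θ : ℝ) :
    IsHeatSolution (heatSeries a θ) := by
  refine ⟨?_, fun x t => ∑' k : ℕ, (k : ℝ) * (a k * exp (-((k : ℝ) ^ 2 * t))) *
      cos (k * x + (θ + π / 2)),
    fun x t => ∑' k : ℕ, (k : ℝ) * ((k : ℝ) * (a k * exp (-((k : ℝ) ^ 2 * t)))) *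
      cos (k * x + (θ + π / 2 + π / 2)), fun x t ht => ?_⟩
  · refine continuousOn_tsum (u := fun k => |a k|) (fun k => by fun_prop) ha.abs fun k q hq => ?_
    have h1 : exp (-((k : ℝ) ^ 2 * q.2)) ≤ 1 :=
      exp_le_one_iff.2 (neg_nonpos.2 (mul_nonneg (sq_nonneg _) hq))
    rw [norm_mul, norm_mul, norm_eq_abs, norm_eq_abs, norm_eq_abs, abs_exp, mul_assoc]
    exact mul_le_of_le_one_right (abs_nonneg _)
      (mul_le_one₀ h1 (abs_nonneg _) (abs_cos_le_one _))
  · have s0 := summable_mul_exp_neg ha ht.le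
    have s1 : Summable fun k : ℕ => (k : ℝ) * (a k * exp (-((k : ℝ) ^ 2 * t))) := by
      refine (summable_pow_mul_exp_neg ha 1 ht).of_norm_bounded fun k => le_of_eq ?_
      simp [mul_assoc]
    have s2 : Summable fun k : ℕ => (k : ℝ) * ((k : ℝ) * (a k * exp (-((k : ℝ) ^ 2 * t)))) := by
      refine (summable_pow_mul_exp_neg ha 2 ht).of_norm_bounded fun k => le_of_eq ?_
      simp [mul_assoc, pow_two]
    refine ⟨hasDerivAt_tsum_mul_cos s0 s1 θ x, hasDerivAt_tsum_mul_cos s1 s2 _ x, ?_⟩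
    refine hasDerivAt_tsum_of_isPreconnected (F := ℝ)
      (g := fun (k : ℕ) s => a k * exp (-((k : ℝ) ^ 2 * s)) * cos (k * x + θ))
      (g' := fun (k : ℕ) s => (k : ℝ) * ((k : ℝ) * (a k * exp (-((k : ℝ) ^ 2 * s)))) *
        cos (k * x + (θ + π / 2 + π / 2))) (t := Ioi (t / 2)) (y₀ := t)
      (summable_pow_mul_exp_neg ha 2 (half_pos ht)) isOpen_Ioi isPreconnected_Ioi
      (fun k s _ => ?_) (fun k s hs => ?_) (half_lt_self ht) ?_ (half_lt_self ht)
    · refine (((hasDerivAt_exp_neg_mul ((k : ℝ) ^ 2) s).const_mul (a k)).mul_const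
        (cos (k * x + θ))).congr_deriv ?_
      rw [add_assoc θ, add_halves, ← add_assoc, cos_add_pi]
      ring
    · have h1 : exp (-((k : ℝ) ^ 2 * s)) ≤ exp (-((k : ℝ) ^ 2 * (t / 2))) :=
        exp_le_exp.2 (neg_le_neg (mul_le_mul_of_nonneg_left (le_of_lt hs) (sq_nonneg _)))
      simp only [norm_mul, norm_eq_abs, abs_exp, Nat.abs_cast]
      calc _ ≤ (k : ℝ) * (k * (|a k| * exp (-((k : ℝ) ^ 2 * s)))) :=
            mul_le_of_le_one_right (by positivity) (abs_cos_le_one _)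
        _ = (k : ℝ) ^ 2 * |a k| * exp (-((k : ℝ) ^ 2 * s)) := by ring
        _ ≤ _ := mul_le_mul_of_nonneg_left h1 (by positivity)
    · refine s0.abs.of_norm_bounded fun k => ?_
      rw [norm_mul, norm_eq_abs, norm_eq_abs]
      exact mul_le_of_le_one_right (abs_nonneg _) (abs_cos_le_one _)

theorem integral_neg_self_eq_add {E : Type*} [NormedAddCommGroup E] [NormedSpace ℝ E] {F : ℝ → E}
    (hF : Continuous F) (r : ℝ) :
    ∫ x in -r..r, F x = ∫ x in (0 : ℝ)..r, (F x + F (-x)) := by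
  have h1 : ∫ x in (0 : ℝ)..r, F (-x) = ∫ x in -r..0, F x := by
    simp
  rw [intervalIntegral.integral_add (hF.intervalIntegrable _ _)
    ((show Continuous fun x => F (-x) by fun_prop).intervalIntegrable _ _), h1, add_comm,
    intervalIntegral.integral_add_adjacent_intervals (hF.intervalIntegrable _ _)
    (hF.intervalIntegrable _ _)]

/-- A continuous even `2π`-periodic function is the sum of its cosine series when the
coefficients are summable. -/
theorem eq_tsum_cos_of_even {f : ℝ → ℝ} (hf : Continuous f) (hper : Function.Periodic f (2 * π))
    (heven : ∀ x, f (-x) = f x) {a : ℕ → ℝ} (ha : Summable a)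
    (hcoeff : ∀ k : ℕ, ∫ x in (0 : ℝ)..π, f x * cos (k * x) =
      if k = 0 then π * a 0 else π / 2 * a k) (x : ℝ) :
    f x = ∑' k : ℕ, a k * cos (k * x) := by
  have : Fact (0 < 2 * π) := ⟨two_pi_pos⟩
  have hper' : Function.Periodic (fun y => (f y : ℂ)) (2 * π) := fun y => by
    simp only [hper y]
  let g : C(AddCircle (2 * π), ℂ) :=
    ⟨hper'.lift, (Complex.continuous_ofReal.comp hf).quotient_lift _⟩
  have hg : ∀ y : ℝ, g (y : AddCircle (2 * π)) = (f y : ℂ) := fun y => rfl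
  have hfou : ∀ (n : ℤ) (y : ℝ), fourier n (y : AddCircle (2 * π)) =
      Complex.exp (((n * y : ℝ) : ℂ) * Complex.I) := fun n y => by
    rw [fourier_coe_apply]
    congr 1
    push_cast
    field_simp
  set A : ℤ → ℂ := fun n => if n = 0 then (a 0 : ℂ) else (a n.natAbs / 2 : ℝ) with hA
  have hcoef : ∀ n : ℤ, fourierCoeff g n = A n := fun n => by
    have hcont : Continuous fun y : ℝ => Complex.exp (((-n : ℤ) * y : ℝ) * Complex.I) * (f y : ℂ) := by
      fun_prop
    have hint : ∫ y in (0 : ℝ)..π, f y * cos (n * y) =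
        if n = 0 then π * a 0 else π / 2 * a n.natAbs := by
      have h1 : ∀ y : ℝ, cos (n * y) = cos (n.natAbs * y) := fun y => by
        rcases Int.natAbs_eq n with h | h
        · conv_lhs => rw [h]
          simp
        · conv_lhs => rw [h]
          simp
      simp only [h1, hcoeff, Int.natAbs_eq_zero]
    rw [fourierCoeff_eq_intervalIntegral g n (-π), show -π + 2 * π = π by ring]
    simp only [hfou, hg, smul_eq_mul]
    rw [integral_neg_self_eq_add hcont]
    have h2 : ∀ y : ℝ, Complex.exp (((-n : ℤ) * y : ℝ) * Complex.I) * (f y : ℂ) +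
        Complex.exp (((-n : ℤ) * (-y) : ℝ) * Complex.I) * (f (-y) : ℂ) =
        ((2 * (f y * cos (n * y)) : ℝ) : ℂ) := fun y => by
      rw [heven]
      push_cast
      rw [Complex.cos]
      ring_nf
    simp only [h2]
    rw [intervalIntegral.integral_ofReal, intervalIntegral.integral_const_mul, hint, hA]
    rcases eq_or_ne n 0 with h | h
    · simp [h]
      field_simp
    · simp [h]
      field_simp
  have hAsum : Summable A := by
    have h1 : Summable fun n : ℕ => ((a n : ℝ) : ℂ) := Complex.summable_ofReal.2 ha
    have h2 : Summable fun n : ℕ => A n := by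
      refine (summable_nat_add_iff 1).1 ?_
      refine (((summable_nat_add_iff 1).2 h1).div_const 2).congr fun n => ?_
      simp [hA, show ((n : ℤ) + 1) ≠ 0 by omega, show ((n : ℤ) + 1).natAbs = n + 1 by omega]
    refine Summable.of_nat_of_neg h2 (h2.congr fun n => ?_)
    simp [hA]
  have hsum := has_pointwise_sum_fourier_series_of_summable (f := g)
    (hAsum.congr fun n => (hcoef n).symm) (x : AddCircle (2 * π))
  simp only [hcoef, hfou, hg, smul_eq_mul] at hsum
  have hsum' := hsum.nat_add_neg.sub (hasSum_ite_eq (0 : ℕ) (a 0 : ℂ))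
  have hfin : HasSum (fun k : ℕ => ((a k * cos (k * x) : ℝ) : ℂ)) (f x : ℂ) := by
    have hval : (f x : ℂ) + A 0 * Complex.exp (((0 : ℤ) * x : ℝ) * Complex.I) - (a 0 : ℂ) = f x := by
      simp [hA]
    rw [hval] at hsum'
    refine (congrArg (fun F => HasSum F (f x : ℂ)) (funext fun k => ?_)).mpr hsum'
    rcases eq_or_ne k 0 with h | h
    · simp [h, hA]
    · simp only [hA, Int.natAbs_neg, Int.natAbs_natCast, neg_eq_zero, Nat.cast_eq_zero, h, if_false,
        sub_zero]
      push_cast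
      rw [Complex.cos]
      ring_nf
  exact (Complex.hasSum_ofReal.1 hfin).tsum_eq.symm

theorem integral_cos_int_mul (n : ℤ) :
    ∫ x in (0 : ℝ)..π, cos (n * x) = if n = 0 then π else 0 := by
  split_ifs with h
  · simp [h]
  · have hn : (n : ℝ) ≠ 0 := by exact_mod_cast h
    rw [intervalIntegral.integral_comp_mul_left (fun y => cos y) hn]
    simp [integral_cos, sin_int_mul_pi]

theorem integral_cos_mul_cos_mul_cos (i j k : ℕ) :
    ∫ x in (0 : ℝ)..π, cos (i * x) * cos (j * x) * cos (k * x) =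
      π / 4 * ((if i + j + k = 0 then 1 else 0) + (if i + j = k then 1 else 0) +
        (if i + k = j then 1 else 0) + (if j + k = i then 1 else 0)) := by
  have h : ∀ x : ℝ, cos (i * x) * cos (j * x) * cos (k * x) =
      1 / 4 * (cos (((i + j + k : ℤ) : ℝ) * x) + cos (((i + j - k : ℤ) : ℝ) * x) +
        cos (((i + k - j : ℤ) : ℝ) * x) + cos (((j + k - i : ℤ) : ℝ) * x)) := fun x => by
    have e1 : ((i + j + k : ℤ) : ℝ) * x = i * x + j * x + k * x := by push_cast; ring
    have e2 : ((i + j - k : ℤ) : ℝ) * x = i * x + j * x - k * x := by push_cast; ring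
    have e3 : ((i + k - j : ℤ) : ℝ) * x = k * x + (i * x - j * x) := by push_cast; ring
    have e4 : ((j + k - i : ℤ) : ℝ) * x = k * x - (i * x - j * x) := by push_cast; ring
    rw [e1, e2, e3, e4, cos_add (_ + _), cos_sub (_ + _), cos_add _ (_ - _), cos_sub _ (_ - _),
      cos_add, cos_sub]
    ring
  have hc : ∀ n : ℤ, IntervalIntegrable (fun x : ℝ => cos (n * x)) MeasureTheory.volume 0 π :=
    fun n => (by fun_prop : Continuous fun x : ℝ => cos (n * x)).intervalIntegrable _ _
  simp only [h]
  rw [intervalIntegral.integral_const_mul, intervalIntegral.integral_add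
    (((hc _).add (hc _)).add (hc _)) (hc _), intervalIntegral.integral_add
    ((hc _).add (hc _)) (hc _), intervalIntegral.integral_add (hc _) (hc _)]
  simp only [integral_cos_int_mul]
  have c1 : ((i : ℤ) + j + k = 0) ↔ i + j + k = 0 := by omega
  have c2 : ((i : ℤ) + j - k = 0) ↔ i + j = k := by omega
  have c3 : ((i : ℤ) + k - j = 0) ↔ i + k = j := by omega
  have c4 : ((j : ℤ) + k - i = 0) ↔ j + k = i := by omega
  simp only [c1, c2, c3, c4]
  have h1 : ∀ (P : Prop) [Decidable P], (if P then π else 0) = π * (if P then (1 : ℝ) else 0) :=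
    fun P _ => by split_ifs <;> simp
  rw [h1, h1, h1, h1]
  ring

theorem tsum_prod_nat_eq_zero_add {G : ℕ × ℕ → ℝ} (hG : Summable G) :
    ∑' q, G q = G (0, 0) + ∑' l, G (0, l + 1) + ∑' m, G (m + 1, 0) +
      ∑' m, ∑' l, G (m + 1, l + 1) := by
  have h1 : ∀ m, ∑' l, G (m, l) = G (m, 0) + ∑' l, G (m, l + 1) := fun m =>
    (hG.prod_factor m).tsum_eq_zero_add
  have hs : Summable fun m => ∑' l, G (m, l) := hG.prod
  have hs0 : Summable fun m => G (m + 1, 0) :=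
    hG.comp_injective (i := fun m : ℕ => (m + 1, 0)) fun a b h => by simpa using h
  have hs1 : Summable fun m => ∑' l, G (m + 1, l + 1) := by
    refine (((summable_nat_add_iff 1).2 hs).sub hs0).congr fun m => ?_
    rw [h1]
    ring
  rw [hG.tsum_prod, hs.tsum_eq_zero_add, h1 0]
  simp only [h1 (_ + 1)]
  rw [hs0.tsum_add hs1]
  ring

theorem tsum_ite_eq_tsum_comp {α β : Type*} {g : β → α} (hg : Function.Injective g) (P : α → Prop)
    [DecidablePred P] (hP : ∀ q, P q ↔ q ∈ range g) (w : α → ℝ) :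
    ∑' q, w q * (if P q then 1 else 0) = ∑' c, w (g c) := by
  rw [← hg.tsum_eq]
  · refine tsum_congr fun c => ?_
    rw [if_pos ((hP _).2 ⟨c, rfl⟩), mul_one]
  · intro q hq
    rw [← hP]
    by_contra h
    simp [h] at hq

theorem integral_tsum_cos_sq_mul {A D : ℕ → ℝ} (hA : Summable A) (hD : Summable D) :
    HasSum (fun q : ℕ × ℕ × ℕ => A q.1 * (A q.2.1 * D q.2.2) *
        ∫ x in (0 : ℝ)..π, cos (q.1 * x) * cos (q.2.1 * x) * cos (q.2.2 * x))
      (∫ x in (0 : ℝ)..π, (∑' k : ℕ, A k * cos (k * x)) ^ 2 * ∑' k : ℕ, D k * cos (k * x)) := by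
  have hw : Summable fun q : ℕ × ℕ × ℕ => ‖A q.1 * (A q.2.1 * D q.2.2)‖ :=
    (summable_mul_of_summable_norm hA.norm (summable_mul_of_summable_norm hA.norm hD.norm).norm).norm
  let F : ℕ × ℕ × ℕ → C(ℝ, ℝ) := fun q =>
    ⟨fun x => A q.1 * cos (q.1 * x) * (A q.2.1 * cos (q.2.1 * x) * (D q.2.2 * cos (q.2.2 * x))),
      by fun_prop⟩
  have hle : ∀ (c y : ℝ), ‖c * cos y‖ ≤ ‖c‖ := fun c y => by
    rw [norm_mul]
    exact mul_le_of_le_one_right (norm_nonneg _) (abs_cos_le_one _)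
  have hcs : ∀ {B : ℕ → ℝ}, Summable B → ∀ x : ℝ, Summable fun k : ℕ => ‖B k * cos (k * x)‖ :=
    fun hB x => hB.norm.of_nonneg_of_le (fun _ => norm_nonneg _) fun k => hle _ _
  have hF : HasSum (fun q => ∫ x in (0 : ℝ)..π, F q x) (∫ x in (0 : ℝ)..π, ∑' q, F q x) := by
    refine intervalIntegral.hasSum_intervalIntegral_of_summable_norm
      (hw.of_nonneg_of_le (fun _ => norm_nonneg _) fun q => ?_)
    refine (ContinuousMap.norm_le _ (norm_nonneg _)).2 fun x => ?_
    have h := mul_le_mul (hle (A q.1) (q.1 * x)) (mul_le_mul (hle (A q.2.1) (q.2.1 * x))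
      (hle (D q.2.2) (q.2.2 * x)) (norm_nonneg _) (norm_nonneg _)) (by positivity) (norm_nonneg _)
    simp only [← norm_mul] at h
    exact h
  convert hF using 1
  · funext q
    rw [← intervalIntegral.integral_const_mul]
    refine intervalIntegral.integral_congr fun x _ => ?_
    simp only [F, ContinuousMap.coe_mk]
    ring
  · refine intervalIntegral.integral_congr fun x _ => ?_
    simp only [F, ContinuousMap.coe_mk]
    rw [pow_two, mul_assoc, tsum_mul_tsum_of_summable_norm (hcs hA x) (hcs hD x),
      tsum_mul_tsum_of_summable_norm (hcs hA x)
        (summable_mul_of_summable_norm (hcs hA x) (hcs hD x)).norm]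

theorem two_mul_integral_tsum_cos_sq_mul {A D : ℕ → ℝ} (hA : Summable A) (hD : Summable D)
    (hD0 : D 0 = 0) :
    2 * ∫ x in (0 : ℝ)..π, (∑' k : ℕ, A k * cos (k * x)) ^ 2 * ∑' k : ℕ, D k * cos (k * x) =
      2 * π * A 0 * (∑' m, A (m + 1) * D (m + 1)) +
      π / 2 * (2 * (∑' m, ∑' l, A (m + 1) * D (l + 1) * A (m + 1 + (l + 1))) +
        ∑' m, ∑' l, A (m + 1) * A (l + 1) * D (m + 1 + (l + 1))) := by
  set w : ℕ × ℕ × ℕ → ℝ := fun q => A q.1 * (A q.2.1 * D q.2.2) with hw_def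
  have hw : Summable w :=
    summable_mul_of_summable_norm hA.norm (summable_mul_of_summable_norm hA.norm hD.norm).norm
  have hwite : ∀ (P : ℕ × ℕ × ℕ → Prop) [DecidablePred P],
      Summable fun q => w q * (if P q then 1 else 0) := fun P _ => by
    refine hw.norm.of_norm_bounded fun q => ?_
    split_ifs <;> simp
  have i1 : Function.Injective fun c : ℕ × ℕ => (c.1, c.2, c.1 + c.2) := fun a b h => by
    simp only [Prod.mk.injEq] at h
    exact Prod.ext h.1 h.2.1
  have i2 : Function.Injective fun c : ℕ × ℕ => (c.1, c.1 + c.2, c.2) := fun a b h => by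
    simp only [Prod.mk.injEq] at h
    exact Prod.ext h.1 h.2.2
  have i3 : Function.Injective fun c : ℕ × ℕ => (c.1 + c.2, c.1, c.2) := fun a b h => by
    simp only [Prod.mk.injEq] at h
    exact Prod.ext h.2.1 h.2.2
  have t1 := tsum_ite_eq_tsum_comp i1 (fun q => q.1 + q.2.1 = q.2.2) (fun ⟨i, j, k⟩ =>
    ⟨fun h => ⟨(i, j), by simpa using h⟩, fun ⟨⟨a, b⟩, h⟩ => by
      simp only [Prod.mk.injEq] at h; show i + j = k; omega⟩) w
  have t2 := tsum_ite_eq_tsum_comp i2 (fun q => q.1 + q.2.2 = q.2.1) (fun ⟨i, j, k⟩ =>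
    ⟨fun h => ⟨(i, k), by simpa using h⟩, fun ⟨⟨a, b⟩, h⟩ => by
      simp only [Prod.mk.injEq] at h; show i + k = j; omega⟩) w
  have t3 := tsum_ite_eq_tsum_comp i3 (fun q => q.2.1 + q.2.2 = q.1) (fun ⟨i, j, k⟩ =>
    ⟨fun h => ⟨(j, k), by simpa using h⟩, fun ⟨⟨a, b⟩, h⟩ => by
      simp only [Prod.mk.injEq] at h; show j + k = i; omega⟩) w
  have s1 : Summable fun c : ℕ × ℕ => A c.1 * A c.2 * D (c.1 + c.2) :=
    (hw.comp_injective i1).congr fun c => by simp only [hw_def, Function.comp]; ring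
  have s2 : Summable fun c : ℕ × ℕ => A c.1 * D c.2 * A (c.1 + c.2) :=
    (hw.comp_injective i2).congr fun c => by simp only [hw_def, Function.comp]; ring
  rw [← (integral_tsum_cos_sq_mul hA hD).tsum_eq]
  have hterm : ∀ q : ℕ × ℕ × ℕ, A q.1 * (A q.2.1 * D q.2.2) *
      (∫ x in (0 : ℝ)..π, cos (q.1 * x) * cos (q.2.1 * x) * cos (q.2.2 * x)) =
      π / 4 * (w q * (if q.1 + q.2.1 = q.2.2 then 1 else 0) +
        w q * (if q.1 + q.2.2 = q.2.1 then 1 else 0) +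
        w q * (if q.2.1 + q.2.2 = q.1 then 1 else 0)) := fun q => by
    rw [integral_cos_mul_cos_mul_cos]
    by_cases h : q.2.2 = 0
    · have : w q = 0 := by simp [hw_def, h, hD0]
      rw [this]
      simp [h, hD0]
    · rw [if_neg (show ¬ q.1 + q.2.1 + q.2.2 = 0 by omega)]
      simp only [hw_def]
      ring
  simp only [hterm]
  rw [tsum_mul_left, ((hwite _).add (hwite _)).tsum_add (hwite _), (hwite _).tsum_add (hwite _),
    t1, t2, t3]
  have e1 : ∑' c : ℕ × ℕ, w (c.1, c.2, c.1 + c.2) = ∑' c : ℕ × ℕ, A c.1 * A c.2 * D (c.1 + c.2) :=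
    tsum_congr fun c => by simp only [hw_def]; ring
  have e2 : ∑' c : ℕ × ℕ, w (c.1, c.1 + c.2, c.2) = ∑' c : ℕ × ℕ, A c.1 * D c.2 * A (c.1 + c.2) :=
    tsum_congr fun c => by simp only [hw_def]; ring
  have e3 : ∑' c : ℕ × ℕ, w (c.1 + c.2, c.1, c.2) = ∑' c : ℕ × ℕ, A c.1 * D c.2 * A (c.1 + c.2) :=
    tsum_congr fun c => by simp only [hw_def]; ring
  rw [e1, e2, e3, tsum_prod_nat_eq_zero_add s1, tsum_prod_nat_eq_zero_add s2]
  have f1 : ∑' l, A 0 * A (l + 1) * D (0 + (l + 1)) = A 0 * ∑' m, A (m + 1) * D (m + 1) := by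
    rw [← tsum_mul_left]
    exact tsum_congr fun l => by rw [zero_add]; ring
  have f2 : ∑' m, A (m + 1) * A 0 * D (m + 1 + 0) = A 0 * ∑' m, A (m + 1) * D (m + 1) := by
    rw [← tsum_mul_left]
    exact tsum_congr fun l => by rw [add_zero]; ring
  have f3 : ∑' l, A 0 * D (l + 1) * A (0 + (l + 1)) = A 0 * ∑' m, A (m + 1) * D (m + 1) := by
    rw [← tsum_mul_left]
    exact tsum_congr fun l => by rw [zero_add]; ring
  simp only [f1, f2, f3, hD0, mul_zero, zero_mul, tsum_zero, add_zero]
  ring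

theorem integral_cos_mul_const (n r : ℝ) :
    ∫ x in (0 : ℝ)..r, cos (n * x) = if n = 0 then r else sin (n * r) / n := by
  split_ifs with h
  · simp [h]
  · rw [intervalIntegral.integral_comp_mul_left (fun y => cos y) h]
    simp [integral_cos, div_eq_inv_mul]

theorem integral_cos_mul_cos (m n r : ℝ) :
    ∫ x in (0 : ℝ)..r, cos (m * x) * cos (n * x) =
      ((∫ x in (0 : ℝ)..r, cos ((n + m) * x)) + ∫ x in (0 : ℝ)..r, cos ((n - m) * x)) / 2 := by
  have hc : ∀ q : ℝ, IntervalIntegrable (fun x : ℝ => cos (q * x)) MeasureTheory.volume 0 r :=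
    fun q => (by fun_prop : Continuous fun x : ℝ => cos (q * x)).intervalIntegrable _ _
  rw [← intervalIntegral.integral_add (hc _) (hc _), ← intervalIntegral.integral_div]
  refine intervalIntegral.integral_congr fun x _ => ?_
  simp only [add_mul, sub_mul, cos_add, cos_sub]
  ring

/-- The even `2π`-periodic function equal to `min (p * x) π` on `[0, π]`. -/
noncomputable def tent (p : ℕ) (x : ℝ) : ℝ := min (p * arccos (cos x)) π

theorem continuous_tent (p : ℕ) : Continuous (tent p) := by
  unfold tent
  fun_prop

theorem tent_neg (p : ℕ) (x : ℝ) : tent p (-x) = tent p x := by simp [tent]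

theorem tent_periodic (p : ℕ) : Function.Periodic (tent p) (2 * π) := fun x => by simp [tent]

theorem tent_of_le {p : ℕ} (hp : 0 < p) {x : ℝ} (h0 : 0 ≤ x) (h1 : x ≤ π / p) :
    tent p x = p * x := by
  have hp' : (1 : ℝ) ≤ p := by exact_mod_cast hp
  have h2 : x ≤ π := h1.trans (div_le_self pi_pos.le hp')
  rw [tent, arccos_cos h0 h2, min_eq_left]
  rwa [le_div_iff₀' (by linarith)] at h1

theorem tent_of_ge {p : ℕ} (hp : 0 < p) {x : ℝ} (h1 : π / p ≤ x) (h2 : x ≤ π) :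
    tent p x = π := by
  have hp' : (0 : ℝ) < p := by exact_mod_cast hp
  rw [tent, arccos_cos ((div_nonneg pi_pos.le hp'.le).trans h1) h2, min_eq_right]
  rwa [div_le_iff₀' hp'] at h1

theorem integral_comp_tent_mul_cos {p : ℕ} (hp : 0 < p) {h : ℝ → ℝ} (hc : Continuous h)
    (hπ : h π = 0) (k : ℕ) :
    ∫ x in (0 : ℝ)..π, h (tent p x) * cos (k * x) =
      ∫ x in (0 : ℝ)..π / p, h (p * x) * cos (k * x) := by
  have hp' : (1 : ℝ) ≤ p := by exact_mod_cast hp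
  have hr0 : 0 ≤ π / p := by positivity
  have hr : π / p ≤ π := div_le_self pi_pos.le hp'
  have hcont : Continuous fun x => h (tent p x) * cos (k * x) :=
    (hc.comp (continuous_tent p)).mul (by fun_prop)
  rw [← intervalIntegral.integral_add_adjacent_intervals (b := π / p)
    (hcont.intervalIntegrable _ _) (hcont.intervalIntegrable _ _)]
  have e1 : ∫ x in (0 : ℝ)..π / p, h (tent p x) * cos (k * x) =
      ∫ x in (0 : ℝ)..π / p, h (p * x) * cos (k * x) := by
    refine intervalIntegral.integral_congr fun x hx => ?_
    rw [uIcc_of_le hr0] at hx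
    simp only [tent_of_le hp hx.1 hx.2]
  have e2 : ∫ x in π / p..π, h (tent p x) * cos (k * x) = ∫ x in π / p..π, (0 : ℝ) := by
    refine intervalIntegral.integral_congr fun x hx => ?_
    rw [uIcc_of_le hr] at hx
    simp only [tent_of_ge hp hx.1 hx.2, hπ, zero_mul]
  rw [e1, e2, intervalIntegral.integral_zero, add_zero]

/-- The coefficients `c p k`, completed by the mean value `1 / p` at `k = 0`. -/
noncomputable def cMean (p k : ℕ) : ℝ := if k = 0 then 1 / (p : ℝ) else c p k

theorem d_zero {p : ℕ} (hp : 0 < p) : d p 0 = 0 := by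
  rw [d, if_neg (by omega)]
  simp

theorem integral_one_add_cos_tent {p : ℕ} (hp : 0 < p) (k : ℕ) :
    ∫ x in (0 : ℝ)..π, (1 + cos (tent p x)) * cos (k * x) =
      if k = 0 then π * cMean p 0 else π / 2 * cMean p k := by
  have hp' : (p : ℝ) ≠ 0 := by exact_mod_cast hp.ne'
  rw [integral_comp_tent_mul_cos hp (h := fun y => 1 + cos y) (by fun_prop) (by simp) k]
  simp only [add_mul, one_mul]
  have hpr : (p : ℝ) * (π / p) = π := by field_simp
  rw [intervalIntegral.integral_add ((by fun_prop : Continuous _).intervalIntegrable _ _)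
    ((by fun_prop : Continuous _).intervalIntegrable _ _), integral_cos_mul_cos]
  simp only [integral_cos_mul_const]
  simp only [add_mul, sub_mul, hpr, sin_add_pi, sin_sub_pi]
  by_cases h0 : k = 0
  · simp only [h0, Nat.cast_zero, zero_mul, sin_zero, neg_zero, zero_div, zero_add, zero_sub,
      neg_eq_zero, hp', if_true, if_false, cMean]
    ring
  have hk : (k : ℝ) ≠ 0 := by exact_mod_cast h0
  have hkp : (k : ℝ) + p ≠ 0 := by positivity
  by_cases h1 : k = p
  · have hsin : sin (k * (π / p)) = 0 := by rw [h1, hpr, sin_pi]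
    rw [if_neg hk, if_neg hkp, if_pos (by rw [h1, sub_self]), hsin, if_neg h0, cMean, if_neg h0, c,
      if_pos h1]
    ring
  have hk' : (k : ℝ) - p ≠ 0 := sub_ne_zero.2 (by exact_mod_cast h1)
  have hden : (p : ℝ) ^ 2 - (k : ℝ) ^ 2 ≠ 0 := by
    rw [show (p : ℝ) ^ 2 - (k : ℝ) ^ 2 = -((k + p) * (k - p)) by ring]
    exact neg_ne_zero.2 (mul_ne_zero hkp hk')
  rw [if_neg hk, if_neg hkp, if_neg hk', if_neg h0, cMean, if_neg h0, c, if_neg h1,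
    show π * (k : ℝ) / p = k * (π / p) by ring]
  field_simp
  ring

theorem integral_cos_add_cos_tent {p : ℕ} (hp : 0 < p) (k : ℕ) :
    ∫ x in (0 : ℝ)..π, (cos (tent p x) + cos (2 * tent p x)) * cos (k * x) =
      if k = 0 then π * d p 0 else π / 2 * d p k := by
  have hp' : (p : ℝ) ≠ 0 := by exact_mod_cast hp.ne'
  rw [integral_comp_tent_mul_cos hp (h := fun y => cos y + cos (2 * y)) (by fun_prop) (by simp) k]
  simp only [add_mul, ← mul_assoc]
  have hpr : (p : ℝ) * (π / p) = π := by field_simp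
  have hpr2 : 2 * (p : ℝ) * (π / p) = 2 * π := by rw [mul_assoc, hpr]
  rw [intervalIntegral.integral_add ((by fun_prop : Continuous _).intervalIntegrable _ _)
    ((by fun_prop : Continuous _).intervalIntegrable _ _), integral_cos_mul_cos,
    integral_cos_mul_cos]
  simp only [integral_cos_mul_const]
  simp only [add_mul, sub_mul, hpr, hpr2, sin_add_pi, sin_sub_pi, sin_add_two_pi, sin_sub_two_pi]
  by_cases h0 : k = 0
  · simp [h0, d_zero hp, hp']
  have hk : (k : ℝ) ≠ 0 := by exact_mod_cast h0
  have hkp : (k : ℝ) + p ≠ 0 := by positivity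
  have hkp2 : (k : ℝ) + 2 * p ≠ 0 := by positivity
  by_cases h1 : k = p
  · have hsin : sin (k * (π / p)) = 0 := by rw [h1, hpr, sin_pi]
    have hk2 : (k : ℝ) - 2 * p ≠ 0 := by
      rw [h1]
      exact fun h => hp' (by linarith)
    rw [if_neg hkp, if_pos (by rw [h1, sub_self]), if_neg hkp2, if_neg hk2, hsin, if_neg h0, d,
      if_pos (Or.inl h1)]
    ring
  by_cases h2 : k = 2 * p
  · have h2' : (k : ℝ) = 2 * p := by exact_mod_cast h2
    have hsin : sin (k * (π / p)) = 0 := by rw [h2', hpr2, sin_two_pi]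
    have hk1 : (k : ℝ) - p ≠ 0 := by
      rw [h2']
      exact fun h => hp' (by linarith)
    rw [if_neg hkp, if_neg hk1, if_neg hkp2, if_pos (by rw [h2', sub_self]), hsin, if_neg h0, d,
      if_pos (Or.inr h2)]
    ring
  have hk' : (k : ℝ) - p ≠ 0 := sub_ne_zero.2 (by exact_mod_cast h1)
  have hk2' : (k : ℝ) - 2 * p ≠ 0 := sub_ne_zero.2 (by exact_mod_cast h2)
  have hden : (p : ℝ) ^ 2 - (k : ℝ) ^ 2 ≠ 0 := by
    rw [show (p : ℝ) ^ 2 - (k : ℝ) ^ 2 = -((k + p) * (k - p)) by ring]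
    exact neg_ne_zero.2 (mul_ne_zero hkp hk')
  have hden2 : 4 * (p : ℝ) ^ 2 - (k : ℝ) ^ 2 ≠ 0 := by
    rw [show 4 * (p : ℝ) ^ 2 - (k : ℝ) ^ 2 = -((k + 2 * p) * (k - 2 * p)) by ring]
    exact neg_ne_zero.2 (mul_ne_zero hkp2 hk2')
  have e1 : -sin (k * (π / p)) / (k + p) + -sin (k * (π / p)) / (k - p) =
      2 * k * sin (k * (π / p)) / ((p : ℝ) ^ 2 - (k : ℝ) ^ 2) := by
    rw [div_add_div _ _ hkp hk', div_eq_div_iff (mul_ne_zero hkp hk') hden]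
    ring
  have e2 : sin (k * (π / p)) / (k + 2 * p) + sin (k * (π / p)) / (k - 2 * p) =
      -(2 * k * sin (k * (π / p))) / (4 * (p : ℝ) ^ 2 - (k : ℝ) ^ 2) := by
    rw [div_add_div _ _ hkp2 hk2', div_eq_div_iff (mul_ne_zero hkp2 hk2') hden2]
    ring
  rw [if_neg hkp, if_neg hk', if_neg hkp2, if_neg hk2', if_neg h0, d, if_neg (by tauto),
    show π * (k : ℝ) / p = k * (π / p) by ring, e1, e2]
  generalize hX : (p : ℝ) ^ 2 - (k : ℝ) ^ 2 = X at hden ⊢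
  generalize hY : 4 * (p : ℝ) ^ 2 - (k : ℝ) ^ 2 = Y at hden2 ⊢
  have hXY : Y - X = 3 * (p : ℝ) ^ 2 := by
    rw [← hX, ← hY]
    ring
  field_simp
  linear_combination 2 * sin (k * π / p) * hXY

theorem summable_mul_c (p : ℕ) : Summable fun k : ℕ => (k : ℝ) * c p k := by
  have hs : Summable fun k : ℕ => 2 * (p : ℝ) ^ 2 * (1 / (k : ℝ) ^ 2) :=
    (summable_one_div_nat_pow.2 one_lt_two).mul_left _
  refine hs.of_norm_bounded_eventually_nat ?_
  filter_upwards [eventually_ge_atTop (2 * p + 1)] with k hk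
  have hk0 : (0 : ℝ) < k := by exact_mod_cast (by omega : 0 < k)
  have hkp : 2 * (p : ℝ) ≤ k := by exact_mod_cast (by omega : 2 * p ≤ k)
  have hp0 : (0 : ℝ) ≤ p := Nat.cast_nonneg p
  have hden : 3 / 4 * (k : ℝ) ^ 2 ≤ |(p : ℝ) ^ 2 - (k : ℝ) ^ 2| := by
    rw [abs_of_nonpos (by nlinarith)]
    nlinarith
  rw [c, if_neg (by omega), norm_eq_abs, abs_mul, abs_div, abs_mul, abs_mul (π * k), abs_mul π,
    abs_of_pos pi_pos, Nat.abs_cast, abs_of_nonneg (by positivity : 0 ≤ 2 * (p : ℝ) ^ 2)]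
  have hπ := pi_gt_three
  calc (k : ℝ) * (2 * (p : ℝ) ^ 2 * |sin (π * k / p)| / (π * k * |(p : ℝ) ^ 2 - (k : ℝ) ^ 2|))
      ≤ (k : ℝ) * (2 * (p : ℝ) ^ 2 * 1 / (3 * k * (3 / 4 * (k : ℝ) ^ 2))) := by
        gcongr
        exact abs_sin_le_one _
    _ = 2 * (p : ℝ) ^ 2 * (1 / (k : ℝ) ^ 2) * (4 / 9) := by field_simp; norm_num
    _ ≤ _ := mul_le_of_le_one_right (by positivity) (by norm_num)

theorem summable_mul_d (p : ℕ) : Summable fun k : ℕ => (k : ℝ) * d p k := by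
  have hs : Summable fun k : ℕ => 6 * (p : ℝ) ^ 2 * (1 / (k : ℝ) ^ 2) :=
    (summable_one_div_nat_pow.2 one_lt_two).mul_left _
  refine hs.of_norm_bounded_eventually_nat ?_
  filter_upwards [eventually_ge_atTop (4 * p + 1)] with k hk
  have hk0 : (0 : ℝ) < k := by exact_mod_cast (by omega : 0 < k)
  have hkp : 4 * (p : ℝ) ≤ k := by exact_mod_cast (by omega : 4 * p ≤ k)
  have hp0 : (0 : ℝ) ≤ p := Nat.cast_nonneg p
  have hden : 3 / 4 * (k : ℝ) ^ 2 ≤ |(p : ℝ) ^ 2 - (k : ℝ) ^ 2| := by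
    rw [abs_of_nonpos (by nlinarith)]
    nlinarith
  have hden2 : 3 / 4 * (k : ℝ) ^ 2 ≤ |4 * (p : ℝ) ^ 2 - (k : ℝ) ^ 2| := by
    rw [abs_of_nonpos (by nlinarith)]
    nlinarith
  rw [d, if_neg (by omega), norm_eq_abs, abs_mul, abs_div, abs_mul, abs_mul _ (k : ℝ),
    abs_mul _ (4 * (p : ℝ) ^ 2 - (k : ℝ) ^ 2), abs_mul π,
    abs_of_pos pi_pos, Nat.abs_cast, abs_of_nonneg (by positivity : 0 ≤ 6 * (p : ℝ) ^ 2)]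
  have hπ := pi_gt_three
  calc (k : ℝ) * (6 * (p : ℝ) ^ 2 * k * |sin (π * k / p)| /
        (π * |(p : ℝ) ^ 2 - (k : ℝ) ^ 2| * |4 * (p : ℝ) ^ 2 - (k : ℝ) ^ 2|))
      ≤ (k : ℝ) * (6 * (p : ℝ) ^ 2 * k * 1 /
        (3 * (3 / 4 * (k : ℝ) ^ 2) * (3 / 4 * (k : ℝ) ^ 2))) := by
        gcongr
        exact abs_sin_le_one _
    _ = 6 * (p : ℝ) ^ 2 * (1 / (k : ℝ) ^ 2) * (16 / 27) := by field_simp; ring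
    _ ≤ _ := mul_le_of_le_one_right (by positivity) (by norm_num)

theorem summable_of_summable_natCast_mul {a : ℕ → ℝ} (ha : Summable fun k : ℕ => (k : ℝ) * a k) :
    Summable a := by
  refine ha.norm.of_norm_bounded_eventually_nat ?_
  filter_upwards [eventually_ge_atTop 1] with k hk
  rw [norm_mul]
  refine le_mul_of_one_le_left (norm_nonneg _) ?_
  simpa using hk

theorem summable_mul_cMean (p : ℕ) : Summable fun k : ℕ => (k : ℝ) * cMean p k := by
  refine (summable_mul_c p).congr fun k => ?_
  rcases eq_or_ne k 0 with h | h <;> simp [cMean, h]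

theorem IsHeatSolution.mode_le {f : ℝ → ℝ → ℝ} (hf : IsHeatSolution f) {a b A q θ : ℝ}
    (h0 : ∀ x ∈ Icc a b, A * cos (q * x + θ) ≤ f x 0) (ha : ∀ t, 0 < t → 0 ≤ f a t)
    (hb : ∀ t, 0 < t → 0 ≤ f b t) (hca : cos (q * a + θ) = 0) (hcb : cos (q * b + θ) = 0) :
    ∀ x ∈ Icc a b, ∀ t, 0 ≤ t → A * exp (-(q ^ 2 * t)) * cos (q * x + θ) ≤ f x t := by
  intro x hx t ht
  refine sub_nonneg.1 ((hf.sub (isHeatSolution_mode A q θ)).nonneg_of_boundary (fun y hy => ?_)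
    (fun s hs => ?_) (fun s hs => ?_) x hx t ht)
  · simpa using h0 y hy
  · simpa [hca] using ha s hs
  · simpa [hcb] using hb s hs

theorem IsHeatSolution.continuous_left {f : ℝ → ℝ → ℝ} (hf : IsHeatSolution f) {t : ℝ}
    (ht : 0 ≤ t) : Continuous fun x => f x t := by
  rw [← continuousOn_univ]
  exact hf.continuousOn.comp (f := fun x : ℝ => (x, t)) (by fun_prop) fun _ _ => ht

theorem cos_sub_pi_div_two' (x : ℝ) : cos (x + -(π / 2)) = sin x := by
  rw [← sub_eq_add_neg, cos_sub_pi_div_two]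

theorem heatSeries_sine_zero (a : ℕ → ℝ) (t : ℝ) : heatSeries a (-(π / 2)) 0 t = 0 := by
  simp [heatSeries]

theorem heatSeries_sine_pi (a : ℕ → ℝ) (t : ℝ) : heatSeries a (-(π / 2)) π t = 0 := by
  simp only [heatSeries, cos_sub_pi_div_two', sin_nat_mul_pi, mul_zero, tsum_zero]

theorem heatSeries_periodic (a : ℕ → ℝ) (θ t : ℝ) :
    Function.Periodic (fun x => heatSeries a θ x t) (2 * π) := fun x => by
  simp only [heatSeries]
  refine tsum_congr fun k => ?_
  rw [show (k : ℝ) * (x + 2 * π) + θ = k * x + θ + k * (2 * π) by ring, cos_add_nat_mul_two_pi]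

theorem summable_cMean (p : ℕ) : Summable (cMean p) :=
  summable_of_summable_natCast_mul (summable_mul_cMean p)

theorem summable_d (p : ℕ) : Summable (d p) :=
  summable_of_summable_natCast_mul (summable_mul_d p)

/-- Heat evolution of the even bump `1 + cos (p * x)` supported on `[-π / p, π / p]`. -/
noncomputable def bump (p : ℕ) : ℝ → ℝ → ℝ := heatSeries (cMean p) 0

/-- Minus the space derivative of `bump`. -/
noncomputable def bumpSlope (p : ℕ) : ℝ → ℝ → ℝ :=
  heatSeries (fun k => (k : ℝ) * cMean p k) (-(π / 2))

/-- The odd primitive of the heat evolution of `cos (p * x) + cos (2 * p * x)`. -/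
noncomputable def primitive (p : ℕ) : ℝ → ℝ → ℝ :=
  heatSeries (fun k => d p k / k) (-(π / 2))

theorem summable_d_div (p : ℕ) : Summable fun k : ℕ => d p k / k := by
  refine (summable_d p).norm.of_norm_bounded fun k => ?_
  rw [norm_div]
  rcases eq_or_ne k 0 with h | h
  · simp [h]
  · refine div_le_self (norm_nonneg _) ?_
    simpa using Nat.one_le_iff_ne_zero.2 h

theorem isHeatSolution_bump (p : ℕ) : IsHeatSolution (bump p) :=
  isHeatSolution_heatSeries (summable_cMean p) _

theorem isHeatSolution_bumpSlope (p : ℕ) : IsHeatSolution (bumpSlope p) :=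
  isHeatSolution_heatSeries (summable_mul_cMean p) _

theorem isHeatSolution_primitive (p : ℕ) : IsHeatSolution (primitive p) :=
  isHeatSolution_heatSeries (summable_d_div p) _

theorem hasDerivAt_bump (p : ℕ) {t : ℝ} (ht : 0 ≤ t) (x : ℝ) :
    HasDerivAt (fun y => bump p y t) (-bumpSlope p x t) x := by
  have hs : Summable fun k : ℕ => (k : ℝ) * (cMean p k * exp (-((k : ℝ) ^ 2 * t))) :=
    (summable_mul_exp_neg (summable_mul_cMean p) ht).congr fun k => by ring
  refine (hasDerivAt_tsum_mul_cos (summable_mul_exp_neg (summable_cMean p) ht) hs 0 x).congr_deriv ?_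
  rw [bumpSlope, heatSeries, ← tsum_neg]
  refine tsum_congr fun k => ?_
  rw [zero_add, cos_add_pi_div_two, cos_sub_pi_div_two']
  ring

theorem hasDerivAt_primitive {p : ℕ} (hp : 0 < p) {t : ℝ} (ht : 0 ≤ t) (x : ℝ) :
    HasDerivAt (fun y => primitive p y t)
      (∑' k : ℕ, d p k * exp (-((k : ℝ) ^ 2 * t)) * cos (k * x)) x := by
  have hk : ∀ k : ℕ, (k : ℝ) * (d p k / k * exp (-((k : ℝ) ^ 2 * t))) =
      d p k * exp (-((k : ℝ) ^ 2 * t)) := fun k => by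
    rcases eq_or_ne k 0 with h | h
    · simp [h, d_zero hp]
    · have : (k : ℝ) ≠ 0 := by exact_mod_cast h
      field_simp
  refine (hasDerivAt_tsum_mul_cos (summable_mul_exp_neg (summable_d_div p) ht)
    ((summable_mul_exp_neg (summable_d p) ht).congr fun k => (hk k).symm) _ x).congr_deriv ?_
  exact tsum_congr fun k => by rw [hk, neg_add_cancel, add_zero]

theorem bump_initial {p : ℕ} (hp : 0 < p) (x : ℝ) : bump p x 0 = 1 + cos (tent p x) := by
  have h := eq_tsum_cos_of_even (f := fun y => 1 + cos (tent p y))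
    (continuous_const.add (continuous_cos.comp (continuous_tent p)))
    (fun y => by simp only [tent_periodic p y]) (fun y => by simp only [tent_neg])
    (summable_cMean p) (integral_one_add_cos_tent hp) x
  simp [h, bump, heatSeries]

theorem tsum_d_mul_cos {p : ℕ} (hp : 0 < p) (x : ℝ) :
    ∑' k : ℕ, d p k * cos (k * x) = cos (tent p x) + cos (2 * tent p x) :=
  (eq_tsum_cos_of_even (f := fun y => cos (tent p y) + cos (2 * tent p y))
    ((continuous_cos.comp (continuous_tent p)).add
      (continuous_cos.comp (continuous_const.mul (continuous_tent p))))
    (fun y => by simp only [tent_periodic p y]) (fun y => by simp only [tent_neg])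
    (summable_d p) (integral_cos_add_cos_tent hp) x).symm

theorem bumpSlope_initial_of_le {p : ℕ} (hp : 0 < p) {x : ℝ} (h0 : 0 ≤ x) (h1 : x < π / p) :
    bumpSlope p x 0 = p * sin (p * x) := by
  rcases h0.eq_or_lt with rfl | h0
  · simp [bumpSlope, heatSeries_sine_zero]
  have hd := hasDerivAt_bump p le_rfl x
  have heq : (fun y => bump p y 0) =ᶠ[𝓝 x] fun y => 1 + cos (p * y) := by
    filter_upwards [Ioo_mem_nhds h0 h1] with y hy
    rw [bump_initial hp, tent_of_le hp hy.1.le hy.2.le]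
  have hd' : HasDerivAt (fun y => 1 + cos (p * y)) (-sin (p * x) * (p * 1)) x :=
    (((hasDerivAt_id x).const_mul (p : ℝ)).cos).const_add 1
  have := hd.unique (hd'.congr_of_eventuallyEq heq)
  linarith

theorem bumpSlope_initial_of_ge {p : ℕ} (hp : 0 < p) {x : ℝ} (h0 : π / p ≤ x) (h1 : x ≤ π) :
    bumpSlope p x 0 = 0 := by
  have hmin : IsLocalMin (fun y => bump p y 0) x := Eventually.of_forall fun y => by
    simp only [bump_initial hp, tent_of_ge hp h0 h1, cos_pi]
    linarith [neg_one_le_cos (tent p y)]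
  exact neg_eq_zero.1 (hmin.hasDerivAt_eq_zero (hasDerivAt_bump p le_rfl x))

theorem natCast_mul_le_pi {p : ℕ} (hp : 0 < p) {x : ℝ} (h : x ≤ π / p) : p * x ≤ π := by
  rwa [le_div_iff₀' (by exact_mod_cast hp)] at h

theorem sin_natCast_mul_nonneg {p : ℕ} (hp : 0 < p) {x : ℝ} (h0 : 0 ≤ x) (h1 : x ≤ π / p) :
    0 ≤ sin (p * x) :=
  sin_nonneg_of_nonneg_of_le_pi (by positivity) (natCast_mul_le_pi hp h1)

theorem bumpSlope_nonneg {p : ℕ} (hp : 0 < p) :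
    ∀ x ∈ Icc 0 π, ∀ t, 0 ≤ t → 0 ≤ bumpSlope p x t := by
  refine (isHeatSolution_bumpSlope p).nonneg_of_boundary (fun x hx => ?_)
    (fun t _ => (heatSeries_sine_zero _ t).ge) (fun t _ => (heatSeries_sine_pi _ t).ge)
  rcases lt_or_ge x (π / p) with h | h
  · rw [bumpSlope_initial_of_le hp hx.1 h]
    exact mul_nonneg (Nat.cast_nonneg p) (sin_natCast_mul_nonneg hp hx.1 h.le)
  · rw [bumpSlope_initial_of_ge hp h hx.2]

theorem pi_div_le_pi {p : ℕ} (hp : 0 < p) : π / p ≤ π :=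
  div_le_self pi_pos.le (by exact_mod_cast hp)

theorem le_bumpSlope {p : ℕ} (hp : 0 < p) {x : ℝ} (hx : x ∈ Icc 0 (π / p)) {t : ℝ} (ht : 0 ≤ t) :
    p * exp (-((p : ℝ) ^ 2 * t)) * sin (p * x) ≤ bumpSlope p x t := by
  have hp' : (p : ℝ) ≠ 0 := by exact_mod_cast hp.ne'
  have hpr : (p : ℝ) * (π / p) = π := by field_simp
  have hpos : 0 ≤ π / p := by positivity
  rw [← cos_sub_pi_div_two' (p * x)]
  refine (isHeatSolution_bumpSlope p).mode_le (fun y hy => ?_)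
    (fun s _ => (heatSeries_sine_zero _ s).ge)
    (fun s hs => bumpSlope_nonneg hp _ ⟨hpos, pi_div_le_pi hp⟩ s hs.le) ?_ ?_ x hx t ht
  · rw [cos_sub_pi_div_two']
    rcases hy.2.lt_or_eq with h | h
    · exact (bumpSlope_initial_of_le hp hy.1 h).ge
    · rw [bumpSlope_initial_of_ge hp h.ge (h.le.trans (pi_div_le_pi hp)), h, hpr, sin_pi, mul_zero]
  · simp
  · rw [cos_sub_pi_div_two', hpr, sin_pi]

theorem hasDerivAt_primitive_initial {p : ℕ} (hp : 0 < p) (x : ℝ) :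
    HasDerivAt (fun y => primitive p y 0) (cos (tent p x) + cos (2 * tent p x)) x := by
  refine (hasDerivAt_primitive hp le_rfl x).congr_deriv ?_
  rw [← tsum_d_mul_cos hp]
  simp

theorem primitive_initial_of_le {p : ℕ} (hp : 0 < p) {x : ℝ} (hx : x ∈ Icc 0 (π / p)) :
    primitive p x 0 = sin (p * x) / p + sin (2 * p * x) / (2 * p) := by
  have hp' : (p : ℝ) ≠ 0 := by exact_mod_cast hp.ne'
  have hd : ∀ y : ℝ, HasDerivAt (fun y => sin (p * y) / p + sin (2 * p * y) / (2 * p))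
      (cos (p * y) + cos (2 * (p * y))) y := fun y => by
    have h1 := (((hasDerivAt_id y).const_mul (p : ℝ)).sin).div_const (p : ℝ)
    have h2 := (((hasDerivAt_id y).const_mul (2 * p : ℝ)).sin).div_const (2 * p : ℝ)
    refine (h1.add h2).congr_deriv ?_
    simp only [id, mul_one]
    field_simp
  refine eq_of_has_deriv_right_eq (f' := fun y => cos (tent p y) + cos (2 * tent p y))
    (fun y _ => (hasDerivAt_primitive_initial hp y).hasDerivWithinAt)
    (fun y hy => ((hd y).congr_deriv ?_).hasDerivWithinAt)
    (fun y _ => (hasDerivAt_primitive_initial hp y).continuousAt.continuousWithinAt)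
    (fun y _ => (hd y).continuousAt.continuousWithinAt) ?_ x hx
  · rw [tent_of_le hp hy.1 hy.2.le]
  · simp [primitive, heatSeries_sine_zero]

theorem primitive_initial_of_ge {p : ℕ} (hp : 0 < p) {x : ℝ} (hx : x ∈ Icc (π / p) π) :
    primitive p x 0 = 0 := by
  have hp' : (p : ℝ) ≠ 0 := by exact_mod_cast hp.ne'
  have hpr : (p : ℝ) * (π / p) = π := by field_simp
  have hpos : 0 ≤ π / p := by positivity
  refine eq_of_has_deriv_right_eq (g := fun _ => 0)
    (f' := fun y => cos (tent p y) + cos (2 * tent p y))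
    (fun y _ => (hasDerivAt_primitive_initial hp y).hasDerivWithinAt)
    (fun y hy => ((hasDerivAt_const y (0 : ℝ)).congr_deriv ?_).hasDerivWithinAt)
    (fun y _ => (hasDerivAt_primitive_initial hp y).continuousAt.continuousWithinAt)
    continuousOn_const ?_ x hx
  · rw [tent_of_ge hp hy.1 hy.2.le]
    simp
  · rw [primitive_initial_of_le hp ⟨hpos, le_rfl⟩, mul_assoc, hpr]
    simp

theorem primitive_nonneg {p : ℕ} (hp : 0 < p) :
    ∀ x ∈ Icc 0 π, ∀ t, 0 ≤ t → 0 ≤ primitive p x t := by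
  refine (isHeatSolution_primitive p).nonneg_of_boundary (fun x hx => ?_)
    (fun t _ => (heatSeries_sine_zero _ t).ge) (fun t _ => (heatSeries_sine_pi _ t).ge)
  rcases le_total x (π / p) with h | h
  · have hp' : (p : ℝ) ≠ 0 := by exact_mod_cast hp.ne'
    have heq : sin (p * x) / p + sin (2 * p * x) / (2 * p) =
        sin (p * x) * (1 + cos (p * x)) / p := by
      rw [mul_assoc 2, sin_two_mul]
      field_simp
    rw [primitive_initial_of_le hp ⟨hx.1, h⟩, heq]
    exact div_nonneg (mul_nonneg (sin_natCast_mul_nonneg hp hx.1 h)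
      (by linarith [neg_one_le_cos (p * x)])) (Nat.cast_nonneg p)
  · rw [primitive_initial_of_ge hp ⟨h, hx.2⟩]

theorem le_primitive {p : ℕ} (hp : 0 < p) {x : ℝ} (hx : x ∈ Icc 0 (π / (2 * p))) {t : ℝ}
    (ht : 0 ≤ t) :
    1 / (2 * p) * exp (-((2 * p : ℝ) ^ 2 * t)) * sin (2 * p * x) ≤ primitive p x t := by
  have hp' : (0 : ℝ) < p := by exact_mod_cast hp
  have hpr : (2 * p : ℝ) * (π / (2 * p)) = π := by field_simp
  have hpos : 0 ≤ π / (2 * p) := by positivity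
  have hle : π / (2 * p) ≤ π / p := div_le_div_of_nonneg_left pi_pos.le hp' (by linarith)
  rw [← cos_sub_pi_div_two' (2 * p * x)]
  refine (isHeatSolution_primitive p).mode_le (fun y hy => ?_)
    (fun s _ => (heatSeries_sine_zero _ s).ge)
    (fun s hs => primitive_nonneg hp _ ⟨hpos, hle.trans (pi_div_le_pi hp)⟩ s hs.le) ?_ ?_ x hx t ht
  · have hy' : y ≤ π / p := hy.2.trans hle
    rw [cos_sub_pi_div_two', primitive_initial_of_le hp ⟨hy.1, hy'⟩]
    have h1 := div_nonneg (sin_natCast_mul_nonneg hp hy.1 hy') hp'.le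
    have h2 : 1 / (2 * p) * sin (2 * p * y) = sin (2 * p * y) / (2 * p) := by ring
    linarith
  · simp
  · rw [cos_sub_pi_div_two', hpr, sin_pi]

theorem bump_nonneg {p : ℕ} (hp : 0 < p) :
    ∀ x ∈ Icc (-π) π, ∀ t, 0 ≤ t → 0 ≤ bump p x t := by
  refine (isHeatSolution_bump p).nonneg (fun x _ => ?_) (fun t _ x _ _ hmin => ?_)
  · rw [bump_initial hp]
    linarith [neg_one_le_cos (tent p x)]
  · refine Eventually.of_forall fun y => ?_
    obtain ⟨z, hz, hyz⟩ := (heatSeries_periodic (cMean p) 0 t).exists_mem_Ico two_pi_pos y (-π)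
    have h : bump p y t = bump p z t := hyz
    simp only [h]
    exact hmin z ⟨hz.1, by linarith [hz.2]⟩

theorem le_bump {p : ℕ} (hp : 0 < p) {x : ℝ} (hx : x ∈ Icc 0 (π / (2 * p))) {t : ℝ}
    (ht : 0 ≤ t) : exp (-((p : ℝ) ^ 2 * t)) * cos (p * x) ≤ bump p x t := by
  have hp' : (0 : ℝ) < p := by exact_mod_cast hp
  have hpos : 0 ≤ π / (2 * p) := by positivity
  have hpr : (p : ℝ) * (π / (2 * p)) = π / 2 := by field_simp
  have hle : π / (2 * p) ≤ π / p := div_le_div_of_nonneg_left pi_pos.le hp' (by linarith)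
  have hle' := hle.trans (pi_div_le_pi hp)
  have h := (isHeatSolution_bump p).mode_le (a := -(π / (2 * p))) (b := π / (2 * p)) (A := 1)
    (q := p) (θ := 0) (fun y hy => ?_)
    (fun s hs => bump_nonneg hp _ ⟨by linarith, by linarith [pi_pos]⟩ s hs.le)
    (fun s hs => bump_nonneg hp _ ⟨by linarith [pi_pos], hle'⟩ s hs.le)
    (by rw [mul_neg, hpr]; simp) (by rw [hpr]; simp) x ⟨by linarith [hx.1], hx.2⟩ t ht
  · simpa using h
  · have habs : tent p y = p * |y| := by
      rcases abs_cases y with ⟨h1, h2⟩ | ⟨h1, h2⟩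
      · rw [h1, tent_of_le hp h2 (hy.2.trans hle)]
      · rw [h1, ← tent_neg, tent_of_le hp (by linarith) (by linarith [hy.1])]
    have hcos : cos (p * |y|) = cos (p * y) := by
      rcases abs_choice y with h | h <;> simp [h]
    rw [bump_initial hp, habs, hcos]
    simp

/-- The cubic functional `∫ u² v` of the heat evolutions, as a series. -/
noncomputable def cubicSeries (p : ℕ) (t : ℝ) : ℝ :=
  (2 * π / (p : ℝ)) * (∑' m : ℕ, c p (m + 1) * d p (m + 1) * exp (-2 * ((m : ℝ) + 1) ^ 2 * t)) +
    (π / 2) * (2 * (∑' m : ℕ, ∑' l : ℕ, F11 p (m + 1) (l + 1) t) +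
      ∑' m : ℕ, ∑' l : ℕ, F12 p (m + 1) (l + 1) t)

theorem exp_mul_exp_mul_exp (m l : ℕ) (t : ℝ) :
    exp (-((m : ℝ) ^ 2 * t)) * exp (-((l : ℝ) ^ 2 * t)) * exp (-(((m + l : ℕ) : ℝ) ^ 2 * t)) =
      exp (-2 * ((m : ℝ) ^ 2 + (l : ℝ) ^ 2 + (m : ℝ) * (l : ℝ)) * t) := by
  rw [← exp_add, ← exp_add]
  congr 1
  push_cast
  ring

theorem cubicSeries_eq_integral {p : ℕ} (hp : 0 < p) {t : ℝ} (ht : 0 ≤ t) :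
    cubicSeries p t = 2 * ∫ x in (0 : ℝ)..π, bump p x t ^ 2 *
      ∑' k : ℕ, d p k * exp (-((k : ℝ) ^ 2 * t)) * cos (k * x) := by
  have h := two_mul_integral_tsum_cos_sq_mul (summable_mul_exp_neg (summable_cMean p) ht)
    (summable_mul_exp_neg (summable_d p) ht) (by simp [d_zero hp])
  have hb : ∀ x, bump p x t = ∑' k : ℕ, cMean p k * exp (-((k : ℝ) ^ 2 * t)) * cos (k * x) :=
    fun x => by simp only [bump, heatSeries, add_zero]
  have hc : ∀ m : ℕ, cMean p (m + 1) = c p (m + 1) := fun m => by simp [cMean]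
  have hc' : ∀ m l : ℕ, cMean p (m + 1 + (l + 1)) = c p (m + 1 + (l + 1)) := fun m l => hc _
  simp only [hb, h, cubicSeries, hc, hc']
  have h0 : cMean p 0 * exp (-(((0 : ℕ) : ℝ) ^ 2 * t)) = 1 / p := by simp [cMean]
  rw [h0]
  congr 1
  · congr 1
    · ring
    · refine tsum_congr fun m => ?_
      have : exp (-2 * ((m : ℝ) + 1) ^ 2 * t) =
          exp (-(((m + 1 : ℕ) : ℝ) ^ 2 * t)) * exp (-(((m + 1 : ℕ) : ℝ) ^ 2 * t)) := by
        rw [← exp_add]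
        congr 1
        push_cast
        ring
      rw [this]
      ring
  · congr 3
    · refine tsum_congr fun m => tsum_congr fun l => ?_
      rw [F11, ← exp_mul_exp_mul_exp]
      ring
    · funext m
      refine tsum_congr fun l => ?_
      rw [F12, ← exp_mul_exp_mul_exp]
      ring

theorem cubicSeries_eq_integral_slope {p : ℕ} (hp : 0 < p) {t : ℝ} (ht : 0 ≤ t) :
    cubicSeries p t =
      4 * ∫ x in (0 : ℝ)..π, bump p x t * bumpSlope p x t * primitive p x t := by
  have hB := (isHeatSolution_bump p).continuous_left ht
  have hS := (isHeatSolution_bumpSlope p).continuous_left ht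
  have hD : Continuous fun x => ∑' k : ℕ, d p k * exp (-((k : ℝ) ^ 2 * t)) * cos (k * x) := by
    have := (isHeatSolution_heatSeries (summable_d p) 0).continuous_left ht
    simpa only [heatSeries, add_zero] using this
  have hparts := intervalIntegral.integral_mul_deriv_eq_deriv_mul (a := 0) (b := π)
    (u := fun x => bump p x t ^ 2) (u' := fun x => -2 * bump p x t * bumpSlope p x t)
    (v := fun x => primitive p x t)
    (fun x _ => ((hasDerivAt_bump p ht x).pow 2).congr_deriv (by push_cast; ring))
    (fun x _ => hasDerivAt_primitive hp ht x)
    (((continuous_const.mul hB).mul hS).intervalIntegrable _ _) (hD.intervalIntegrable _ _)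
  rw [cubicSeries_eq_integral hp ht, hparts]
  have e0 : primitive p 0 t = 0 := heatSeries_sine_zero _ t
  have e1 : primitive p π t = 0 := heatSeries_sine_pi _ t
  have e2 : ∀ x, -2 * bump p x t * bumpSlope p x t * primitive p x t =
      -2 * (bump p x t * bumpSlope p x t * primitive p x t) := fun x => by ring
  simp only [e0, e1, e2, intervalIntegral.integral_const_mul]
  ring

theorem exists_le_cubicSeries {p : ℕ} (hp : 0 < p) :
    ∃ K : ℝ, 0 < K ∧ ∀ t, 0 ≤ t → K * exp (-(6 * (p : ℝ) ^ 2 * t)) ≤ cubicSeries p t := by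
  have hp' : (0 : ℝ) < p := by exact_mod_cast hp
  have hpos : 0 < π / (2 * p) := by positivity
  have hpr : (p : ℝ) * (π / (2 * p)) = π / 2 := by field_simp
  have hle : π / (2 * p) ≤ π / p := div_le_div_of_nonneg_left pi_pos.le hp' (by linarith)
  have hle' := hle.trans (pi_div_le_pi hp)
  set g : ℝ → ℝ := fun x => cos (p * x) * (p * sin (p * x)) * (1 / (2 * p) * sin (2 * p * x)) with hg
  have hgc : Continuous g := by fun_prop
  have hlt : ∀ x ∈ Icc 0 (π / (2 * p)), p * x ≤ π / 2 := fun x hx => by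
    rw [← hpr]
    exact mul_le_mul_of_nonneg_left hx.2 hp'.le
  refine ⟨4 * ∫ x in (0 : ℝ)..π / (2 * p), g x, mul_pos (by norm_num)
    (intervalIntegral.intervalIntegral_pos_of_pos_on (hgc.intervalIntegrable _ _) (fun x hx => ?_)
      hpos), fun t ht => ?_⟩
  · have h0 : 0 < p * x := mul_pos hp' hx.1
    have h1 : p * x < π / 2 := by
      rw [← hpr]
      exact mul_lt_mul_of_pos_left hx.2 hp'
    have hc := cos_pos_of_mem_Ioo (x := p * x) ⟨by linarith, h1⟩
    have hs := sin_pos_of_pos_of_lt_pi h0 (by linarith)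
    have hs2 := sin_pos_of_pos_of_lt_pi (x := 2 * p * x) (by linarith) (by linarith)
    positivity
  · have hF : Continuous fun x => bump p x t * bumpSlope p x t * primitive p x t :=
      (((isHeatSolution_bump p).continuous_left ht).mul
        ((isHeatSolution_bumpSlope p).continuous_left ht)).mul
        ((isHeatSolution_primitive p).continuous_left ht)
    have hF0 : ∀ x ∈ Icc 0 π, 0 ≤ bump p x t * bumpSlope p x t * primitive p x t := fun x hx =>
      mul_nonneg (mul_nonneg (bump_nonneg hp x ⟨by linarith [hx.1, pi_pos], hx.2⟩ t ht)
        (bumpSlope_nonneg hp x hx t ht)) (primitive_nonneg hp x hx t ht)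
    have hmono : ∫ x in (0 : ℝ)..π / (2 * p), bump p x t * bumpSlope p x t * primitive p x t ≤
        ∫ x in (0 : ℝ)..π, bump p x t * bumpSlope p x t * primitive p x t := by
      refine intervalIntegral.integral_mono_interval le_rfl hpos.le hle' ?_
        (hF.intervalIntegrable _ _)
      filter_upwards [MeasureTheory.ae_restrict_mem measurableSet_Ioc] with x hx
      exact hF0 x ⟨hx.1.le, hx.2⟩
    have hge : ∫ x in (0 : ℝ)..π / (2 * p), exp (-(6 * (p : ℝ) ^ 2 * t)) * g x ≤
        ∫ x in (0 : ℝ)..π / (2 * p), bump p x t * bumpSlope p x t * primitive p x t := by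
      refine intervalIntegral.integral_mono_on hpos.le
        ((continuous_const.mul hgc).intervalIntegrable _ _) (hF.intervalIntegrable _ _)
        fun x hx => ?_
      have hx' : x ∈ Icc 0 π := ⟨hx.1, hx.2.trans hle'⟩
      have hexp : exp (-(6 * (p : ℝ) ^ 2 * t)) = exp (-((p : ℝ) ^ 2 * t)) *
          exp (-((p : ℝ) ^ 2 * t)) * exp (-((2 * p : ℝ) ^ 2 * t)) := by
        rw [← exp_add, ← exp_add]
        congr 1
        ring
      have h0 : 0 ≤ p * x := mul_nonneg hp'.le hx.1
      have hs := sin_nonneg_of_nonneg_of_le_pi h0 (by linarith [hlt x hx, pi_pos])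
      have hs2 := sin_nonneg_of_nonneg_of_le_pi (x := 2 * p * x) (by linarith)
        (by linarith [hlt x hx])
      calc exp (-(6 * (p : ℝ) ^ 2 * t)) * g x
          = (exp (-((p : ℝ) ^ 2 * t)) * cos (p * x)) *
            (p * exp (-((p : ℝ) ^ 2 * t)) * sin (p * x)) *
            (1 / (2 * p) * exp (-((2 * p : ℝ) ^ 2 * t)) * sin (2 * p * x)) := by
            rw [hexp, hg]
            ring
        _ ≤ _ := by
            have hB := bump_nonneg hp x ⟨by linarith [hx.1, pi_pos], hx'.2⟩ t ht
            have hS := bumpSlope_nonneg hp x hx' t ht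
            exact mul_le_mul (mul_le_mul (le_bump hp hx ht)
              (le_bumpSlope hp ⟨hx.1, hx.2.trans hle⟩ ht) (by positivity) hB)
              (le_primitive hp hx ht) (by positivity) (mul_nonneg hB hS)
    rw [cubicSeries_eq_integral_slope hp ht]
    rw [intervalIntegral.integral_const_mul] at hge
    linarith

theorem abs_tsum_mul_exp_le {ι : Type*} {w : ι → ℝ} (hw : Summable w) {e : ι → ℝ} {r : ℝ}
    (he : ∀ i, e i ≤ r) : |∑' i, w i * exp (e i)| ≤ (∑' i, |w i|) * exp r := by
  refine tsum_of_norm_bounded (f := fun i => w i * exp (e i))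
    (hw.abs.hasSum.mul_right (exp r)) fun i => ?_
  rw [norm_mul, norm_eq_abs, norm_eq_abs, abs_exp]
  exact mul_le_mul_of_nonneg_left (exp_le_exp.2 (he i)) (abs_nonneg _)

theorem summable_mul_exp_of_le {ι : Type*} {w : ι → ℝ} (hw : Summable w) {e : ι → ℝ} {r : ℝ}
    (he : ∀ i, e i ≤ r) : Summable fun i => w i * exp (e i) := by
  refine (hw.abs.mul_right (exp r)).of_norm_bounded fun i => ?_
  rw [norm_mul, norm_eq_abs, norm_eq_abs, abs_exp]
  exact mul_le_mul_of_nonneg_left (exp_le_exp.2 (he i)) (abs_nonneg _)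

theorem summable_mul_mul_add {A B G : ℕ → ℝ} (hA : Summable A) (hB : Summable B)
    (hG : Summable G) :
    Summable fun q : ℕ × ℕ => A (q.1 + 1) * B (q.2 + 1) * G (q.1 + 1 + (q.2 + 1)) := by
  obtain ⟨M, hM⟩ := hG.abs.tendsto_atTop_zero.bddAbove_range
  refine ((summable_mul_of_summable_norm ((summable_nat_add_iff 1).2 hA).norm
    ((summable_nat_add_iff 1).2 hB).norm).norm.mul_right M).of_norm_bounded fun q => ?_
  rw [norm_mul]
  exact mul_le_mul_of_nonneg_left (hM ⟨_, rfl⟩) (norm_nonneg _)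

theorem exists_sub_le_cubicSeries (p : ℕ) :
    ∃ K : ℝ, 0 ≤ K ∧ ∀ t, 0 ≤ t →
      2 * π / p * (c p 1 * d p 1) * exp (-2 * t) - K * exp (-6 * t) ≤ cubicSeries p t := by
  have hc : Summable (c p) := summable_of_summable_natCast_mul (summable_mul_c p)
  have hd := summable_d p
  have hcd : Summable fun m => c p (m + 1) * d p (m + 1) := by
    have h := summable_mul_of_summable_norm hc.norm hd.norm
    exact h.comp_injective (i := fun m : ℕ => (m + 1, m + 1)) fun a b h => by simpa using h
  have hcd' := (summable_nat_add_iff 1).2 hcd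
  have h11 := summable_mul_mul_add hc hd hc
  have h12 := summable_mul_mul_add hc hc hd
  refine ⟨2 * π / p * (∑' m, |c p (m + 1 + 1) * d p (m + 1 + 1)|) +
    π / 2 * (2 * (∑' q : ℕ × ℕ, |c p (q.1 + 1) * d p (q.2 + 1) * c p (q.1 + 1 + (q.2 + 1))|) +
      ∑' q : ℕ × ℕ, |c p (q.1 + 1) * c p (q.2 + 1) * d p (q.1 + 1 + (q.2 + 1))|), ?_,
    fun t ht => ?_⟩
  · have := pi_pos
    have n1 : 0 ≤ ∑' m : ℕ, |c p (m + 1 + 1) * d p (m + 1 + 1)| :=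
      tsum_nonneg fun _ => abs_nonneg _
    have n2 : 0 ≤ ∑' q : ℕ × ℕ, |c p (q.1 + 1) * d p (q.2 + 1) * c p (q.1 + 1 + (q.2 + 1))| :=
      tsum_nonneg fun _ => abs_nonneg _
    have n3 : 0 ≤ ∑' q : ℕ × ℕ, |c p (q.1 + 1) * c p (q.2 + 1) * d p (q.1 + 1 + (q.2 + 1))| :=
      tsum_nonneg fun _ => abs_nonneg _
    positivity
  have hE : ∀ q : ℕ × ℕ, -2 * (((q.1 + 1 : ℕ) : ℝ) ^ 2 + ((q.2 + 1 : ℕ) : ℝ) ^ 2 +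
      ((q.1 + 1 : ℕ) : ℝ) * ((q.2 + 1 : ℕ) : ℝ)) * t ≤ -6 * t := fun q => by
    refine mul_le_mul_of_nonneg_right ?_ ht
    push_cast
    have h1 : (0 : ℝ) ≤ q.1 := Nat.cast_nonneg _
    have h2 : (0 : ℝ) ≤ q.2 := Nat.cast_nonneg _
    nlinarith [mul_nonneg h1 h2]
  have hS : ∀ m : ℕ, -2 * (((m + 1 : ℕ) : ℝ) + 1) ^ 2 * t ≤ -6 * t := fun m => by
    refine mul_le_mul_of_nonneg_right ?_ ht
    push_cast
    have h1 : (0 : ℝ) ≤ m := Nat.cast_nonneg _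
    nlinarith
  have hS0 : ∀ m : ℕ, -2 * ((m : ℝ) + 1) ^ 2 * t ≤ 0 := fun m => by
    have : 0 ≤ ((m : ℝ) + 1) ^ 2 * t := by positivity
    linarith
  have b1 := (abs_le.1 (abs_tsum_mul_exp_le hcd' hS)).1
  have b2 := (abs_le.1 (abs_tsum_mul_exp_le h11 hE)).1
  have b3 := (abs_le.1 (abs_tsum_mul_exp_le h12 hE)).1
  rw [(summable_mul_exp_of_le h11 hE).tsum_prod] at b2
  rw [(summable_mul_exp_of_le h12 hE).tsum_prod] at b3
  have hπ := pi_pos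
  have hp0 : 0 ≤ 2 * π / p := by positivity
  rw [cubicSeries, (summable_mul_exp_of_le hcd hS0).tsum_eq_zero_add]
  simp only [F11, F12]
  have e0 : exp (-2 * (((0 : ℕ) : ℝ) + 1) ^ 2 * t) = exp (-2 * t) := by simp
  rw [e0, zero_add]
  have b1' := mul_le_mul_of_nonneg_left b1 hp0
  have b23 := mul_le_mul_of_nonneg_left (add_le_add (mul_le_mul_of_nonneg_left b2 zero_le_two) b3)
    (by positivity : 0 ≤ π / 2)
  linarith

theorem c_one_mul_d_one_pos {p : ℕ} (hp : 2 ≤ p) : 0 < c p 1 * d p 1 := by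
  have hp' : (2 : ℝ) ≤ p := by exact_mod_cast hp
  have hs : 0 < sin (π * (1 : ℕ) / p) := by
    refine sin_pos_of_pos_of_lt_pi (by positivity) ?_
    rw [Nat.cast_one, mul_one]
    exact div_lt_self pi_pos (by linarith)
  have h1 : 0 < (p : ℝ) ^ 2 - ((1 : ℕ) : ℝ) ^ 2 := by
    rw [Nat.cast_one]
    nlinarith
  have h2 : 0 < 4 * (p : ℝ) ^ 2 - ((1 : ℕ) : ℝ) ^ 2 := by
    rw [Nat.cast_one]
    nlinarith
  rw [c, d, if_neg (by omega), if_neg (by omega)]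
  positivity

theorem J1_lower_bound (p : ℕ) (hp : 3 ≤ p) :
    ∃ C₁ : ℝ, 0 < C₁ ∧ ∀ t : ℝ, 0 ≤ t →
      C₁ * Real.exp (-6 * t) ≤
        (2 * Real.pi / (p : ℝ)) *
            (∑' m : ℕ, c p (m + 1) * d p (m + 1) *
              Real.exp (-2 * ((m : ℝ) + 1)^2 * t))
        + (Real.pi / 2) *
            (2 * (∑' m : ℕ, ∑' l : ℕ, F11 p (m + 1) (l + 1) t)
              + ∑' m : ℕ, ∑' l : ℕ, F12 p (m + 1) (l + 1) t) := by
  obtain ⟨K, hK, hlow⟩ := exists_le_cubicSeries (p := p) (by omega)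
  obtain ⟨L, hL, hlarge⟩ := exists_sub_le_cubicSeries p
  have hp' : (0 : ℝ) < p := by exact_mod_cast (by omega : 0 < p)
  set A : ℝ := 2 * π / p * (c p 1 * d p 1) with hA
  have hApos : 0 < A :=
    mul_pos (div_pos two_pi_pos hp') (c_one_mul_d_one_pos (by omega))
  set T : ℝ := (L + 1) / A with hT
  refine ⟨min 1 (K * exp (-(6 * (p : ℝ) ^ 2 * T))), lt_min one_pos (by positivity),
    fun t ht => ?_⟩
  change _ ≤ cubicSeries p t
  rcases le_total t T with h | h
  · refine le_trans ?_ (hlow t ht)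
    calc min 1 (K * exp (-(6 * (p : ℝ) ^ 2 * T))) * exp (-6 * t)
        ≤ K * exp (-(6 * (p : ℝ) ^ 2 * T)) * 1 := by
          gcongr
          · exact min_le_right _ _
          · exact exp_le_one_iff.2 (by linarith)
      _ ≤ K * exp (-(6 * (p : ℝ) ^ 2 * t)) := by
          rw [mul_one]
          gcongr
  · refine le_trans ?_ (hlarge t ht)
    have h1 : L + 1 ≤ A * t := by
      rw [hT, div_le_iff₀ hApos] at h
      linarith
    have h2 : L + 1 ≤ A * exp (4 * t) := by
      nlinarith [add_one_le_exp (4 * t)]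
    have h3 : exp (-2 * t) = exp (4 * t) * exp (-6 * t) := by
      rw [← exp_add]
      congr 1
      ring
    have h4 := mul_le_mul_of_nonneg_right h2 (exp_pos (-6 * t)).le
    have h5 : min 1 (K * exp (-(6 * (p : ℝ) ^ 2 * T))) * exp (-6 * t) ≤ 1 * exp (-6 * t) :=
      mul_le_mul_of_nonneg_right (min_le_left _ _) (exp_pos _).le
    rw [h3]
    linarith
end

section
/- Let p ≥ 2 be a natural number and define c, d as in the context. Then for every real t ≥ 0, the series ∑_{m=1}^∞ c(m)·d(m)·e^{−2m²t} is strictly positive. -/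
/-- Away from the exceptional indices, `c p k * d p k` is
`12 * sin (π * k / p) ^ 2 / (π ^ 2 * p ^ 2)` times this profile at `k / p`. -/
noncomputable def profile (u : ℝ) : ℝ := 1 / ((u ^ 2 - 1) ^ 2 * (4 - u ^ 2))

theorem c_mul_d_eq_profile {p k : ℕ} (hp : p ≠ 0) (h1 : k ≠ p) (h2 : k ≠ 2 * p) :
    c p k * d p k =
      12 * Real.sin (Real.pi * k / p) ^ 2 / (Real.pi ^ 2 * (p : ℝ) ^ 2) * profile (k / p) := by
  have hp' : (p : ℝ) ≠ 0 := by exact_mod_cast hp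
  rcases Nat.eq_zero_or_pos k with rfl | hk
  · simp [c, d, hp, hp.symm]
  have hk' : (k : ℝ) ≠ 0 := by exact_mod_cast hk.ne'
  have hlin : ∀ q : ℕ, k ≠ q → (q : ℝ) ^ 2 - (k : ℝ) ^ 2 ≠ 0 := by
    intro q hq h
    apply hq
    have : (k : ℝ) ^ 2 = (q : ℝ) ^ 2 := by linarith
    have := (pow_left_inj₀ (Nat.cast_nonneg k) (Nat.cast_nonneg q) two_ne_zero).1 this
    exact_mod_cast this
  have e1 := hlin p h1
  have e2 : 4 * (p : ℝ) ^ 2 - (k : ℝ) ^ 2 ≠ 0 := by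
    have := hlin (2 * p) h2
    push_cast at this
    intro h
    apply this
    linarith
  have hprof : profile (k / p) =
      (p : ℝ) ^ 6 / (((p : ℝ) ^ 2 - (k : ℝ) ^ 2) ^ 2 * (4 * (p : ℝ) ^ 2 - (k : ℝ) ^ 2)) := by
    have a1 : ((k : ℝ) / p) ^ 2 - 1 = -((p : ℝ) ^ 2 - (k : ℝ) ^ 2) / (p : ℝ) ^ 2 := by
      field_simp
      ring
    have a2 : 4 - ((k : ℝ) / p) ^ 2 = (4 * (p : ℝ) ^ 2 - (k : ℝ) ^ 2) / (p : ℝ) ^ 2 := by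
      field_simp
    rw [profile, a1, a2]
    field_simp
  rw [hprof, c, d, if_neg h1, if_neg (by tauto)]
  have := Real.pi_ne_zero
  field_simp
  ring

theorem abs_c_mul_d_le {p k : ℕ} (hp : p ≠ 0) (hk : 2 * p < k) :
    |c p k * d p k| ≤ 12 * (p : ℝ) ^ 4 * (1 / (k : ℝ) ^ 2) := by
  have hp1 : (1 : ℝ) ≤ p := by exact_mod_cast Nat.one_le_iff_ne_zero.2 hp
  have hk1 : 2 * (p : ℝ) + 1 ≤ k := by exact_mod_cast hk
  have b1 : (k : ℝ) ≤ (k : ℝ) ^ 2 - (p : ℝ) ^ 2 := by nlinarith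
  have b2 : 1 ≤ (k : ℝ) ^ 2 - 4 * (p : ℝ) ^ 2 := by nlinarith
  have hk0 : (0 : ℝ) < k := by linarith
  have hpi := Real.pi_gt_three
  have hform : c p k * d p k = -(12 * (p : ℝ) ^ 4 * (Real.sin (Real.pi * k / p) ^ 2 /
      (Real.pi ^ 2 * ((k : ℝ) ^ 2 - (p : ℝ) ^ 2) ^ 2 * ((k : ℝ) ^ 2 - 4 * (p : ℝ) ^ 2)))) := by
    have e1 : (p : ℝ) ^ 2 - (k : ℝ) ^ 2 = -((k : ℝ) ^ 2 - (p : ℝ) ^ 2) := by ring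
    have e2 : 4 * (p : ℝ) ^ 2 - (k : ℝ) ^ 2 = -((k : ℝ) ^ 2 - 4 * (p : ℝ) ^ 2) := by ring
    have n1 : (k : ℝ) ^ 2 - (p : ℝ) ^ 2 ≠ 0 := by linarith
    have n2 : (k : ℝ) ^ 2 - 4 * (p : ℝ) ^ 2 ≠ 0 := by linarith
    rw [c, d, if_neg (by omega), if_neg (by omega), e1, e2]
    field_simp
    ring
  have hden : (k : ℝ) ^ 2 ≤
      Real.pi ^ 2 * ((k : ℝ) ^ 2 - (p : ℝ) ^ 2) ^ 2 * ((k : ℝ) ^ 2 - 4 * (p : ℝ) ^ 2) :=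
    calc (k : ℝ) ^ 2 = 1 * (k : ℝ) ^ 2 * 1 := by ring
      _ ≤ _ := by
        gcongr
        nlinarith
  have hnn : (0 : ℝ) ≤ Real.sin (Real.pi * k / p) ^ 2 /
      (Real.pi ^ 2 * ((k : ℝ) ^ 2 - (p : ℝ) ^ 2) ^ 2 * ((k : ℝ) ^ 2 - 4 * (p : ℝ) ^ 2)) :=
    div_nonneg (sq_nonneg _) ((sq_nonneg _).trans hden)
  rw [hform, abs_neg, abs_of_nonneg (by positivity)]
  gcongr
  exact Real.sin_sq_le_one _

theorem summable_c_mul_d_mul {p : ℕ} (hp : p ≠ 0) {w : ℕ → ℝ}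
    (hw0 : ∀ k, 0 ≤ w k) (hw1 : ∀ k, w k ≤ 1) :
    Summable fun k => c p k * d p k * w k := by
  refine Summable.of_norm_bounded_eventually_nat
    (g := fun k : ℕ => 12 * (p : ℝ) ^ 4 * (1 / (k : ℝ) ^ 2))
    ((Real.summable_one_div_nat_pow.2 one_lt_two).mul_left _) ?_
  filter_upwards [Filter.eventually_gt_atTop (2 * p)] with k hk
  rw [norm_mul, Real.norm_eq_abs, Real.norm_eq_abs, abs_of_nonneg (hw0 k)]
  exact (mul_le_of_le_one_right (abs_nonneg _) (hw1 k)).trans (abs_c_mul_d_le hp hk)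

theorem profile_nonneg {u : ℝ} (h0 : 0 ≤ u) (h2 : u ≤ 2) : 0 ≤ profile u := by
  have : 0 ≤ 4 - u ^ 2 := by nlinarith
  unfold profile
  positivity

theorem profile_nonpos {u : ℝ} (h2 : 2 ≤ u) : profile u ≤ 0 := by
  have : 4 - u ^ 2 ≤ 0 := by nlinarith
  exact one_div_nonpos.2 (mul_nonpos_of_nonneg_of_nonpos (sq_nonneg _) this)

theorem quarter_le_profile {s : ℝ} (h0 : 0 < s) (h1 : s < 1) : 1 / 4 ≤ profile s := by
  have hs : s ^ 2 < 1 := by nlinarith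
  have hs0 : 0 < s ^ 2 := by positivity
  have hpos : 0 < (s ^ 2 - 1) ^ 2 := by
    have : s ^ 2 - 1 ≠ 0 := by linarith
    positivity
  refine one_div_le_one_div_of_le (mul_pos hpos (by linarith)) ?_
  have : (s ^ 2 - 1) ^ 2 ≤ 1 := by nlinarith
  nlinarith

theorem profile_add_one_add_profile_add_two_nonneg {s : ℝ} (h0 : 0 < s) (h1 : s < 1) :
    0 ≤ profile (s + 1) + profile (s + 2) := by
  have hpos1 : 0 < ((s + 1) ^ 2 - 1) ^ 2 * (4 - (s + 1) ^ 2) := by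
    have a : (s + 1) ^ 2 - 1 = s * (s + 2) := by ring
    have b : 4 - (s + 1) ^ 2 = (1 - s) * (s + 3) := by ring
    have : 0 < 1 - s := by linarith
    rw [a, b]
    positivity
  have hneg : profile (s + 2) = -(1 / (((s + 2) ^ 2 - 1) ^ 2 * ((s + 2) ^ 2 - 4))) := by
    rw [profile, ← neg_sub ((s + 2) ^ 2) 4, mul_neg, div_neg]
  have hle : ((s + 1) ^ 2 - 1) ^ 2 * (4 - (s + 1) ^ 2) ≤
      ((s + 2) ^ 2 - 1) ^ 2 * ((s + 2) ^ 2 - 4) := by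
    have e1 : ((s + 1) ^ 2 - 1) ^ 2 * (4 - (s + 1) ^ 2) =
      s * ((s + 2) ^ 2 * (s * (1 - s) * (s + 3))) := by ring
    have e2 : ((s + 2) ^ 2 - 1) ^ 2 * ((s + 2) ^ 2 - 4) =
      s * ((s + 3) ^ 2 * ((s + 1) ^ 2 * (s + 4))) := by ring
    rw [e1, e2]
    have : s * (1 - s) ≤ (s + 1) ^ 2 := by nlinarith
    gcongr <;> linarith
  have := one_div_le_one_div_of_le hpos1 hle
  rw [hneg, profile]
  linarith

theorem neg_le_profile_add {s : ℝ} (h0 : 0 < s) {n : ℝ} (hn : 3 ≤ n) :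
    -(1 / (2 * (n * (n + 1)))) ≤ profile (s + n) := by
  have hneg : profile (s + n) = -(1 / (((s + n) ^ 2 - 1) ^ 2 * ((s + n) ^ 2 - 4))) := by
    rw [profile, ← neg_sub ((s + n) ^ 2) 4, mul_neg, div_neg]
  rw [hneg, neg_le_neg_iff]
  refine one_div_le_one_div_of_le (by positivity) ?_
  have hsq : n ^ 2 ≤ (s + n) ^ 2 := by gcongr; linarith
  have a' : n + 1 ≤ (s + n) ^ 2 - 1 := by nlinarith
  have a : n * (n + 1) ≤ ((s + n) ^ 2 - 1) ^ 2 := by nlinarith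
  have b : 2 ≤ (s + n) ^ 2 - 4 := by nlinarith
  rw [mul_comm 2]
  gcongr

theorem lower_bound_sum_profile {s : ℝ} (h0 : 0 < s) (h1 : s < 1) (N : ℕ) :
    1 / 12 + 1 / (2 * ((N : ℝ) + 3)) ≤ ∑ n ∈ Finset.range (N + 3), profile (s + n) := by
  induction N with
  | zero =>
    have a := quarter_le_profile h0 h1
    have b := profile_add_one_add_profile_add_two_nonneg h0 h1
    simp only [Finset.sum_range_succ, Finset.sum_range_zero, zero_add]
    norm_num at a b ⊢
    linarith
  | succ N ih =>
    rw [show N + 1 + 3 = (N + 3) + 1 by ring, Finset.sum_range_succ]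
    have h := neg_le_profile_add h0 (n := (N : ℝ) + 3) (by linarith [N.cast_nonneg (α := ℝ)])
    have e : 1 / (2 * ((N : ℝ) + 3)) - 1 / (2 * (((N : ℝ) + 3) * ((N : ℝ) + 3 + 1))) =
        1 / (2 * (((N + 1 : ℕ) : ℝ) + 3)) := by
      push_cast
      field_simp
      ring
    push_cast at h e ⊢
    linarith

/-- Since the profile changes sign from positive to negative at `2`, an antitone weight can be
replaced by its value at `2` in a lower bound. -/
theorem profile_mul_le_profile_mul {w : ℝ → ℝ} (hw : AntitoneOn w (Set.Ici 0)) {u : ℝ}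
    (hu : 0 ≤ u) : profile u * w 2 ≤ profile u * w u := by
  have h2 : (2 : ℝ) ∈ Set.Ici 0 := by norm_num
  rcases le_total u 2 with h | h
  · exact mul_le_mul_of_nonneg_left (hw hu h2 h) (profile_nonneg hu h)
  · exact mul_le_mul_of_nonpos_left (hw h2 hu h) (profile_nonpos h)

theorem tsum_profile_mul_pos {w : ℝ → ℝ} (hw : AntitoneOn w (Set.Ici 0)) (hw2 : 0 < w 2)
    {s : ℝ} (h0 : 0 < s) (h1 : s < 1)
    (hsum : Summable fun n : ℕ => profile (s + n) * w (s + n)) :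
    0 < ∑' n : ℕ, profile (s + n) * w (s + n) := by
  refine lt_of_lt_of_le (show 0 < 1 / 12 * w 2 by positivity)
    (ge_of_tendsto hsum.hasSum.tendsto_sum_nat ?_)
  filter_upwards [Filter.eventually_ge_atTop 3] with N hN
  obtain ⟨M, rfl⟩ := Nat.exists_eq_add_of_le' hN
  calc 1 / 12 * w 2 ≤ (∑ n ∈ Finset.range (M + 3), profile (s + n)) * w 2 := by
        gcongr
        refine le_trans ?_ (lower_bound_sum_profile h0 h1 M)
        have : (0 : ℝ) ≤ 1 / (2 * ((M : ℝ) + 3)) := by positivity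
        linarith
    _ ≤ _ := by
        rw [Finset.sum_mul]
        exact Finset.sum_le_sum fun n _ => profile_mul_le_profile_mul hw (by positivity)

theorem c_mul_d_mul_self {p : ℕ} (hp : p ≠ 0) (n : ℕ) (hn : n ≠ 1) :
    c p (p * n) * d p (p * n) = 0 := by
  have hp' : (p : ℝ) ≠ 0 := by exact_mod_cast hp
  have h : p * n ≠ p := by simpa [hp] using hn
  have hs : Real.sin (Real.pi * (p * n : ℕ) / p) = 0 := by
    rw [show Real.pi * ((p * n : ℕ) : ℝ) / p = n * Real.pi by push_cast; field_simp]
    exact Real.sin_nat_mul_pi n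
  rw [c, if_neg h, hs]
  simp

theorem tsum_residue_class_pos {p : ℕ} (hp : p ≠ 0) {w : ℝ → ℝ}
    (hw : AntitoneOn w (Set.Ici 0)) (hw0 : ∀ u, 0 < w u) {j : ℕ} (hj : j < p)
    (hsum : Summable fun n : ℕ =>
      c p (j + p * n) * d p (j + p * n) * w ((j + p * n : ℕ) / p)) :
    0 < ∑' n : ℕ, c p (j + p * n) * d p (j + p * n) * w ((j + p * n : ℕ) / p) := by
  have hp' : (0 : ℝ) < p := by exact_mod_cast Nat.pos_of_ne_zero hp
  rcases Nat.eq_zero_or_pos j with rfl | hj0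
  · rw [tsum_eq_single 1]
    · have := hw0 ((0 + p * 1 : ℕ) / p)
      simp only [zero_add, mul_one] at this ⊢
      simp only [c, d, if_true, true_or]
      positivity
    · intro n hn
      rw [zero_add, c_mul_d_mul_self hp n hn, zero_mul]
  · set A : ℝ := 12 * Real.sin (Real.pi * j / p) ^ 2 / (Real.pi ^ 2 * (p : ℝ) ^ 2) with hA
    have hj' : (0 : ℝ) < j := by exact_mod_cast hj0
    have hjp : (j : ℝ) < p := by exact_mod_cast hj
    have hs1 : (j : ℝ) / p < 1 := (div_lt_one hp').2 hjp
    have hsin : 0 < Real.sin (Real.pi * j / p) := by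
      refine Real.sin_pos_of_pos_of_lt_pi (by positivity) ?_
      rw [mul_div_assoc]
      exact mul_lt_of_lt_one_right Real.pi_pos hs1
    have hApos : 0 < A := by positivity
    have key : ∀ n : ℕ, c p (j + p * n) * d p (j + p * n) * w ((j + p * n : ℕ) / p) =
        A * (profile ((j : ℝ) / p + n) * w ((j : ℝ) / p + n)) := by
      intro n
      have hne : ∀ q : ℕ, j + p * n ≠ p * q := by
        intro q h
        have : p ∣ j := (Nat.dvd_add_left (dvd_mul_right p n)).1 (h ▸ dvd_mul_right p q)
        exact absurd (Nat.le_of_dvd hj0 this) (by omega)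
      have hdiv : ((j + p * n : ℕ) : ℝ) / p = (j : ℝ) / p + n := by
        push_cast
        field_simp
      have hsn : Real.sin (Real.pi * (j + p * n : ℕ) / p) ^ 2 =
          Real.sin (Real.pi * j / p) ^ 2 := by
        rw [mul_div_assoc, hdiv, mul_add, mul_comm Real.pi (n : ℝ), Real.sin_add_nat_mul_pi,
          mul_pow, ← pow_mul, mul_comm n 2, pow_mul]
        simp [mul_div_assoc]
      rw [c_mul_d_eq_profile hp (by simpa using hne 1) (by simpa [mul_comm] using hne 2),
        hsn, hdiv, hA]
      ring
    simp only [key] at hsum ⊢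
    rw [tsum_mul_left]
    exact mul_pos hApos (tsum_profile_mul_pos hw (hw0 2) (by positivity) hs1
      ((summable_mul_left_iff hApos.ne').1 hsum))

theorem J10_pos (p : ℕ) (hp : 2 ≤ p) (t : ℝ) (ht : 0 ≤ t) :
    0 < ∑' m : ℕ, c p (m + 1) * d p (m + 1) *
          Real.exp (-2 * ((m : ℝ) + 1)^2 * t) := by
  have hp0 : p ≠ 0 := by omega
  have hp' : (p : ℝ) ≠ 0 := by exact_mod_cast hp0
  have : NeZero p := ⟨hp0⟩
  set w : ℝ → ℝ := fun u => Real.exp (-2 * (p * u) ^ 2 * t) with hw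
  have hanti : AntitoneOn w (Set.Ici 0) := by
    intro u hu v _ huv
    have hu' : (0 : ℝ) ≤ u := hu
    have : (p * u) ^ 2 * t ≤ (p * v) ^ 2 * t := by gcongr
    exact Real.exp_le_exp.2 (by linarith)
  have hw1 : ∀ u, w u ≤ 1 := fun u => Real.exp_le_one_iff.2 (by
    have : 0 ≤ (p * u) ^ 2 * t := by positivity
    linarith)
  have hsum : Summable fun k : ℕ => c p k * d p k * w (k / p) :=
    summable_c_mul_d_mul hp0 (fun _ => (Real.exp_pos _).le) (fun _ => hw1 _)
  have hshift : ∑' m : ℕ, c p (m + 1) * d p (m + 1) * Real.exp (-2 * ((m : ℝ) + 1) ^ 2 * t) =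
      ∑' k : ℕ, c p k * d p k * w (k / p) := by
    rw [hsum.tsum_eq_zero_add]
    have hc : c p 0 = 0 := by simp [c, hp0.symm]
    rw [hc, zero_mul, zero_mul, zero_add]
    refine tsum_congr fun m => ?_
    simp only [hw, mul_div_cancel₀ _ hp']
    push_cast
    rfl
  rw [hshift, Nat.sumByResidueClasses hsum p]
  refine Finset.sum_pos (fun j _ => ?_) Finset.univ_nonempty
  refine tsum_residue_class_pos hp0 hanti (fun _ => Real.exp_pos _) (ZMod.val_lt j)
    (hsum.comp_injective (i := fun n => j.val + p * n) ?_)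
  intro a b hab
  simpa [hp0] using hab
end

section
/- Let p ≥ 2 be a natural number and define c, d as in the context. Then: (i) c(pl) = 0 for every integer l ≥ 2, and d(pl) = 0 for every integer l ≥ 3; (ii) c(k) > 0 whenever 0 < k < 2p, and also whenever (2l+1)p < k < (2l+2)p for some integer l ≥ 1; (iii) c(k) < 0 whenever 2lp < k < (2l+1)p for some integer l ≥ 1; (iv) d(k) > 0 whenever 0 < k < 3p, and also whenever (2l+2)p < k < (2l+3)p for some integer l ≥ 1; (v) d(k) < 0 whenever (2l+1)p < k < (2l+2)p for some integer l ≥ 1. -/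
lemma sin_pi_mul_div_pos {p k l : ℕ} (h₁ : 2 * l * p < k) (h₂ : k < (2 * l + 1) * p) :
    0 < Real.sin (Real.pi * k / p) := by
  have hp : (0 : ℝ) < p := by
    rcases Nat.eq_zero_or_pos p with rfl | hp
    · simp at h₂
    · exact_mod_cast hp
  have h₁' : 2 * (l : ℝ) * p < k := by exact_mod_cast h₁
  have h₂' : (k : ℝ) < (2 * l + 1) * p := by exact_mod_cast h₂
  rw [← Real.sin_sub_nat_mul_two_pi _ l]
  have e : Real.pi * k / p - l * (2 * Real.pi) = Real.pi * ((k - 2 * l * p) / p) := by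
    field_simp
  rw [e]
  have hpos : 0 < ((k : ℝ) - 2 * l * p) / p := div_pos (by linarith) hp
  have hlt : ((k : ℝ) - 2 * l * p) / p < 1 := by rw [div_lt_one hp]; linarith
  apply Real.sin_pos_of_pos_of_lt_pi
  · exact mul_pos Real.pi_pos hpos
  · exact mul_lt_of_lt_one_right Real.pi_pos hlt

lemma sin_pi_mul_div_neg {p k l : ℕ} (h₁ : (2 * l + 1) * p < k) (h₂ : k < (2 * l + 2) * p) :
    Real.sin (Real.pi * k / p) < 0 := by
  have hp : (p : ℝ) ≠ 0 := by
    rintro h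
    rw [Nat.cast_eq_zero.mp h] at h₂
    simp at h₂
  have h := sin_pi_mul_div_pos (p := p) (k := k + p) (l := l + 1) (by linarith) (by linarith)
  have e : Real.pi * ((k + p : ℕ) : ℝ) / p = Real.pi * k / p + Real.pi := by
    push_cast
    field_simp
  rw [e, Real.sin_add_pi] at h
  linarith

lemma sin_pi_mul_mul_div_self {p : ℕ} (hp : p ≠ 0) (l : ℕ) :
    Real.sin (Real.pi * ((p * l : ℕ) : ℝ) / p) = 0 := by
  have hp' : (p : ℝ) ≠ 0 := Nat.cast_ne_zero.mpr hp
  have e : Real.pi * ((p * l : ℕ) : ℝ) / p = l * Real.pi := by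
    push_cast
    field_simp
  rw [e, Real.sin_nat_mul_pi]

lemma sq_sub_sq_pos_of_lt {a k : ℕ} (h : k < a) : 0 < (a : ℝ) ^ 2 - (k : ℝ) ^ 2 := by
  have h' : (k : ℝ) ^ 2 < (a : ℝ) ^ 2 := by
    exact_mod_cast Nat.pow_lt_pow_left h two_ne_zero
  linarith

lemma sq_sub_sq_neg_of_lt {a k : ℕ} (h : a < k) : (a : ℝ) ^ 2 - (k : ℝ) ^ 2 < 0 := by
  linarith [sq_sub_sq_pos_of_lt h]

lemma four_mul_sq_sub_sq_pos_of_lt {p k : ℕ} (h : k < 2 * p) :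
    0 < 4 * (p : ℝ) ^ 2 - (k : ℝ) ^ 2 := by
  have := sq_sub_sq_pos_of_lt h
  push_cast at this
  linarith

lemma four_mul_sq_sub_sq_neg_of_lt {p k : ℕ} (h : 2 * p < k) :
    4 * (p : ℝ) ^ 2 - (k : ℝ) ^ 2 < 0 := by
  have := sq_sub_sq_neg_of_lt h
  push_cast at this
  linarith

lemma c_pos_of_sin_neg {p k : ℕ} (hp : 0 < p) (hk : p < k)
    (hs : Real.sin (Real.pi * k / p) < 0) : 0 < c p k := by
  have hp' : (0 : ℝ) < p := by exact_mod_cast hp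
  have hk' : (0 : ℝ) < k := by exact_mod_cast hp.trans hk
  rw [c, if_neg hk.ne']
  exact div_pos_of_neg_of_neg (mul_neg_of_pos_of_neg (by positivity) hs)
    (mul_neg_of_pos_of_neg (mul_pos Real.pi_pos hk') (sq_sub_sq_neg_of_lt hk))

lemma c_neg_of_sin_pos {p k : ℕ} (hp : 0 < p) (hk : p < k)
    (hs : 0 < Real.sin (Real.pi * k / p)) : c p k < 0 := by
  have hp' : (0 : ℝ) < p := by exact_mod_cast hp
  have hk' : (0 : ℝ) < k := by exact_mod_cast hp.trans hk
  rw [c, if_neg hk.ne']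
  exact div_neg_of_pos_of_neg (by positivity)
    (mul_neg_of_pos_of_neg (mul_pos Real.pi_pos hk') (sq_sub_sq_neg_of_lt hk))

lemma d_pos_of_sin_pos {p k : ℕ} (hp : 0 < p) (hk : 2 * p < k)
    (hs : 0 < Real.sin (Real.pi * k / p)) : 0 < d p k := by
  have hp' : (0 : ℝ) < p := by exact_mod_cast hp
  have hk' : (0 : ℝ) < k := by exact_mod_cast (by omega : 0 < k)
  rw [d, if_neg (by omega)]
  exact div_pos (by positivity)
    (mul_pos_of_neg_of_neg (mul_neg_of_pos_of_neg Real.pi_pos (sq_sub_sq_neg_of_lt (by omega)))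
      (four_mul_sq_sub_sq_neg_of_lt hk))

lemma d_neg_of_sin_neg {p k : ℕ} (hp : 0 < p) (hk : 2 * p < k)
    (hs : Real.sin (Real.pi * k / p) < 0) : d p k < 0 := by
  have hp' : (0 : ℝ) < p := by exact_mod_cast hp
  have hk' : (0 : ℝ) < k := by exact_mod_cast (by omega : 0 < k)
  rw [d, if_neg (by omega)]
  exact div_neg_of_neg_of_pos (mul_neg_of_pos_of_neg (by positivity) hs)
    (mul_pos_of_neg_of_neg (mul_neg_of_pos_of_neg Real.pi_pos (sq_sub_sq_neg_of_lt (by omega)))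
      (four_mul_sq_sub_sq_neg_of_lt hk))

lemma c_pos_of_lt_two_mul {p k : ℕ} (hk : 0 < k) (hkp : k < 2 * p) : 0 < c p k := by
  have hp : 0 < p := by omega
  have hp' : (0 : ℝ) < p := by exact_mod_cast hp
  have hk' : (0 : ℝ) < k := by exact_mod_cast hk
  rcases lt_trichotomy k p with h | rfl | h
  · have hs : 0 < Real.sin (Real.pi * k / p) :=
      sin_pi_mul_div_pos (l := 0) (by simpa using hk) (by simpa using h)
    rw [c, if_neg h.ne]
    exact div_pos (by positivity) (mul_pos (mul_pos Real.pi_pos hk') (sq_sub_sq_pos_of_lt h))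
  · rw [c, if_pos rfl]
    positivity
  · exact c_pos_of_sin_neg hp h (sin_pi_mul_div_neg (l := 0) (by simpa using h) (by simpa using hkp))

lemma d_pos_of_lt_three_mul {p k : ℕ} (hk : 0 < k) (hkp : k < 3 * p) : 0 < d p k := by
  have hp : 0 < p := by omega
  have hp' : (0 : ℝ) < p := by exact_mod_cast hp
  have hk' : (0 : ℝ) < k := by exact_mod_cast hk
  by_cases hc : k = p ∨ k = 2 * p
  · rw [d, if_pos hc]
    positivity
  obtain h | ⟨h₁, h₂⟩ | h : k < p ∨ (p < k ∧ k < 2 * p) ∨ 2 * p < k := by omega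
  · have hs : 0 < Real.sin (Real.pi * k / p) :=
      sin_pi_mul_div_pos (l := 0) (by simpa using hk) (by simpa using h)
    rw [d, if_neg hc]
    exact div_pos (by positivity) (mul_pos (mul_pos Real.pi_pos (sq_sub_sq_pos_of_lt h))
      (four_mul_sq_sub_sq_pos_of_lt (by omega)))
  · have hs : Real.sin (Real.pi * k / p) < 0 :=
      sin_pi_mul_div_neg (l := 0) (by simpa using h₁) (by simpa using h₂)
    rw [d, if_neg hc]
    exact div_pos_of_neg_of_neg (mul_neg_of_pos_of_neg (by positivity) hs)
      (mul_neg_of_neg_of_pos (mul_neg_of_pos_of_neg Real.pi_pos (sq_sub_sq_neg_of_lt h₁))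
        (four_mul_sq_sub_sq_pos_of_lt h₂))
  · exact d_pos_of_sin_pos hp h (sin_pi_mul_div_pos (l := 1) (by simpa using h) (by simpa using hkp))

theorem cd_signs (p : ℕ) (hp : 2 ≤ p) :
    (∀ l : ℕ, 2 ≤ l → c p (p * l) = 0) ∧
    (∀ l : ℕ, 3 ≤ l → d p (p * l) = 0) ∧
    (∀ k : ℕ, 0 < k → k < 2 * p → 0 < c p k) ∧
    (∀ k l : ℕ, 1 ≤ l → (2 * l + 1) * p < k → k < (2 * l + 2) * p → 0 < c p k) ∧
    (∀ k l : ℕ, 1 ≤ l → 2 * l * p < k → k < (2 * l + 1) * p → c p k < 0) ∧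
    (∀ k : ℕ, 0 < k → k < 3 * p → 0 < d p k) ∧
    (∀ k l : ℕ, 1 ≤ l → (2 * l + 2) * p < k → k < (2 * l + 3) * p → 0 < d p k) ∧
    (∀ k l : ℕ, 1 ≤ l → (2 * l + 1) * p < k → k < (2 * l + 2) * p → d p k < 0) := by
  have hp0 : 0 < p := by omega
  refine ⟨fun l hl => ?_, fun l hl => ?_, fun k hk hkp => c_pos_of_lt_two_mul hk hkp,
    fun k l hl h₁ h₂ => ?_, fun k l hl h₁ h₂ => ?_, fun k hk hkp => d_pos_of_lt_three_mul hk hkp,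
    fun k l hl h₁ h₂ => ?_, fun k l hl h₁ h₂ => ?_⟩
  · rw [c, if_neg (by nlinarith), sin_pi_mul_mul_div_self hp0.ne', mul_zero, zero_div]
  · have hne : ¬(p * l = p ∨ p * l = 2 * p) := by
      rintro (h | h) <;> nlinarith
    rw [d, if_neg hne, sin_pi_mul_mul_div_self hp0.ne', mul_zero, zero_div]
  · exact c_pos_of_sin_neg hp0 (by nlinarith) (sin_pi_mul_div_neg h₁ h₂)
  · exact c_neg_of_sin_pos hp0 (by nlinarith) (sin_pi_mul_div_pos h₁ h₂)
  · exact d_pos_of_sin_pos hp0 (by nlinarith) (sin_pi_mul_div_pos (l := l + 1) h₁ h₂)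
  · exact d_neg_of_sin_neg hp0 (by nlinarith) (sin_pi_mul_div_neg h₁ h₂)
end

section
/- Let p ≥ 2 be a natural number and define c, d as in the context. For positive integers m, l the signs of the product c(m)·c(l)·d(m+l) are distributed as follows: (i) if pa < m < p(a+1) and pb < l < p(b+1) with integers a, b ≥ 1, then c(m)c(l)d(m+l) > 0 when m + l < p(a+b+1) and c(m)c(l)d(m+l) < 0 when m + l > p(a+b+1); (ii) if a ≥ 2 and either (pa < m < p(a+1) and 0 < l < p) or (0 < m < p and pa < l < p(a+1)), then c(m)c(l)d(m+l) < 0 when m + l < p(a+1) and c(m)c(l)d(m+l) > 0 when m + l > p(a+1); (iii) if 0 < m < 2p, 0 < l < 2p and m + l < 3p, then c(m)c(l)d(m+l) > 0. -/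
theorem neg_one_pow_mul_sin_pos {p q k : ℕ} (h₁ : p * q < k) (h₂ : k < p * (q + 1)) :
    0 < (-1 : ℝ) ^ q * Real.sin (Real.pi * k / p) := by
  have hp : (0 : ℝ) < p := by
    exact_mod_cast Nat.pos_of_ne_zero (by rintro rfl; simp at h₂)
  have h₁' : (p : ℝ) * q < k := by exact_mod_cast h₁
  have h₂' : (k : ℝ) < p * (q + 1) := by exact_mod_cast h₂
  rw [← Real.sin_sub_nat_mul_pi]
  apply Real.sin_pos_of_pos_of_lt_pi
  · rw [sub_pos, lt_div_iff₀ hp]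
    nlinarith [Real.pi_pos]
  · rw [sub_lt_iff_lt_add, div_lt_iff₀ hp]
    nlinarith [Real.pi_pos]

theorem c_pos_of_lt {p k : ℕ} (hk : 0 < k) (h : k < p) : 0 < c p k := by
  have hs := neg_one_pow_mul_sin_pos (p := p) (q := 0) (k := k) (by simpa) (by simpa)
  rw [pow_zero, one_mul] at hs
  have hk' : (0 : ℝ) < k := by exact_mod_cast hk
  have h' : (k : ℝ) < p := by exact_mod_cast h
  have hp : (0 : ℝ) < p := hk'.trans h'
  have h₁ : 0 < (p : ℝ) ^ 2 - (k : ℝ) ^ 2 := by nlinarith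
  rw [c, if_neg h.ne]
  have := Real.pi_pos
  positivity

theorem neg_one_pow_mul_c_pos {p q k : ℕ} (hq : 1 ≤ q) (h₁ : p * q < k)
    (h₂ : k < p * (q + 1)) : 0 < (-1 : ℝ) ^ (q + 1) * c p k := by
  have hs := neg_one_pow_mul_sin_pos h₁ h₂
  have hpk : p < k := (Nat.le_mul_of_pos_right p hq).trans_lt h₁
  have hp : (0 : ℝ) < p := by
    exact_mod_cast Nat.pos_of_ne_zero (by rintro rfl; simp at h₂)
  have hpk' : (p : ℝ) < k := by exact_mod_cast hpk
  have hk : (0 : ℝ) < k := hp.trans hpk'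
  have hd : 0 < (k : ℝ) ^ 2 - (p : ℝ) ^ 2 := by nlinarith
  have hπ := Real.pi_pos
  have key : (-1 : ℝ) ^ (q + 1) * c p k =
      2 * (p : ℝ) ^ 2 * ((-1 : ℝ) ^ q * Real.sin (Real.pi * k / p)) /
        (Real.pi * k * ((k : ℝ) ^ 2 - (p : ℝ) ^ 2)) := by
    rw [c, if_neg hpk.ne', ← neg_sub ((k : ℝ) ^ 2), mul_neg, div_neg]
    ring
  rw [key]
  positivity

theorem c_pos {p k : ℕ} (hk : 0 < k) (h : k < 2 * p) : 0 < c p k := by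
  rcases lt_trichotomy k p with hlt | rfl | hgt
  · exact c_pos_of_lt hk hlt
  · rw [c, if_pos rfl]
    positivity
  · simpa using neg_one_pow_mul_c_pos (q := 1) le_rfl (by simpa) (by omega)

theorem neg_one_pow_mul_d_pos {p q k : ℕ} (hq : 2 ≤ q) (h₁ : p * q < k)
    (h₂ : k < p * (q + 1)) : 0 < (-1 : ℝ) ^ q * d p k := by
  have hs := neg_one_pow_mul_sin_pos h₁ h₂
  have hpk : p * 2 < k := (Nat.mul_le_mul_left p hq).trans_lt h₁
  have hp : (0 : ℝ) < p := by
    exact_mod_cast Nat.pos_of_ne_zero (by rintro rfl; simp at h₂)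
  have hpk' : (p : ℝ) * 2 < k := by exact_mod_cast hpk
  have hk : (0 : ℝ) < k := by linarith
  have hd₁ : 0 < (k : ℝ) ^ 2 - (p : ℝ) ^ 2 := by nlinarith
  have hd₂ : 0 < (k : ℝ) ^ 2 - 4 * (p : ℝ) ^ 2 := by nlinarith
  have hπ := Real.pi_pos
  have key : (-1 : ℝ) ^ q * d p k =
      6 * (p : ℝ) ^ 2 * k * ((-1 : ℝ) ^ q * Real.sin (Real.pi * k / p)) /
        (Real.pi * ((k : ℝ) ^ 2 - (p : ℝ) ^ 2) * ((k : ℝ) ^ 2 - 4 * (p : ℝ) ^ 2)) := by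
    rw [d, if_neg (by omega), ← neg_sub ((k : ℝ) ^ 2), ← neg_sub ((k : ℝ) ^ 2), mul_neg,
      mul_neg, neg_mul, neg_neg]
    ring
  rw [key]
  positivity

theorem d_pos {p k : ℕ} (hk : 0 < k) (h : k < 3 * p) : 0 < d p k := by
  have hp : (0 : ℝ) < p := by exact_mod_cast (by omega : 0 < p)
  by_cases hkp : k = p ∨ k = 2 * p
  · rw [d, if_pos hkp]
    positivity
  have hk' : (0 : ℝ) < k := by exact_mod_cast hk
  have hπ := Real.pi_pos
  rcases lt_or_ge (2 * p) k with h₂ | h₂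
  · simpa using neg_one_pow_mul_d_pos (q := 2) le_rfl (by omega) (by omega)
  have h₂' : (k : ℝ) < 2 * p := by exact_mod_cast (by omega : k < 2 * p)
  have hd₂ : 0 < 4 * (p : ℝ) ^ 2 - (k : ℝ) ^ 2 := by nlinarith
  have hd : d p k = 3 * (k : ℝ) ^ 2 * c p k / (4 * (p : ℝ) ^ 2 - (k : ℝ) ^ 2) := by
    rw [d, c, if_neg hkp, if_neg (by tauto)]
    field_simp
    ring
  rw [hd]
  have := c_pos hk (by omega : k < 2 * p)
  positivity

theorem ccd_sign_distribution (p : ℕ) (hp : 2 ≤ p) :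
    (∀ a b m l : ℕ, 1 ≤ a → 1 ≤ b →
      p * a < m → m < p * (a + 1) → p * b < l → l < p * (b + 1) →
      (m + l < p * (a + b + 1) → 0 < c p m * c p l * d p (m + l)) ∧
      (p * (a + b + 1) < m + l → c p m * c p l * d p (m + l) < 0)) ∧
    (∀ a m l : ℕ, 2 ≤ a →
      ((p * a < m ∧ m < p * (a + 1) ∧ 0 < l ∧ l < p) ∨
       (0 < m ∧ m < p ∧ p * a < l ∧ l < p * (a + 1))) →
      (m + l < p * (a + 1) → c p m * c p l * d p (m + l) < 0) ∧
      (p * (a + 1) < m + l → 0 < c p m * c p l * d p (m + l))) ∧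
    (∀ m l : ℕ, 0 < m → m < 2 * p → 0 < l → l < 2 * p → m + l < 3 * p →
      0 < c p m * c p l * d p (m + l)) := by
  refine ⟨fun a b m l ha hb hm₁ hm₂ hl₁ hl₂ ↦ ?_, fun a m l ha h ↦ ?_,
    fun m l hm hm' hl hl' h ↦ mul_pos (mul_pos (c_pos hm hm') (c_pos hl hl')) (d_pos (by omega) h)⟩
  · have hc := mul_pos (neg_one_pow_mul_c_pos ha hm₁ hm₂) (neg_one_pow_mul_c_pos hb hl₁ hl₂)
    have hsq : (-1 : ℝ) ^ (a + b) * (-1) ^ (a + b) = 1 := by simp [← mul_pow]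
    have hcc : 0 < (-1 : ℝ) ^ (a + b) * (c p m * c p l) := by
      exact hc.trans_eq (by ring)
    constructor <;> intro h
    · have hd := neg_one_pow_mul_d_pos (q := a + b) (k := m + l) (by omega) (by linarith) h
      linear_combination mul_pos hcc hd + c p m * c p l * d p (m + l) * hsq
    · have hd := neg_one_pow_mul_d_pos (q := a + b + 1) (k := m + l) (by omega) h (by linarith)
      linear_combination mul_pos hcc hd - c p m * c p l * d p (m + l) * hsq
  · have hcc : 0 < (-1 : ℝ) ^ (a + 1) * (c p m * c p l) := by
      rcases h with ⟨hm₁, hm₂, hl₁, hl₂⟩ | ⟨hm₁, hm₂, hl₁, hl₂⟩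
      · exact (mul_pos (neg_one_pow_mul_c_pos (by omega) hm₁ hm₂)
          (c_pos_of_lt hl₁ hl₂)).trans_eq (by ring)
      · exact (mul_pos (neg_one_pow_mul_c_pos (by omega) hl₁ hl₂)
          (c_pos_of_lt hm₁ hm₂)).trans_eq (by ring)
    have hsq : (-1 : ℝ) ^ a * (-1) ^ a = 1 := by simp [← mul_pow]
    have h₁ : p * a < m + l := by omega
    have h₂ : m + l < p * (a + 1 + 1) := by rw [mul_add p (a + 1)]; omega
    constructor <;> intro h
    · have hd := neg_one_pow_mul_d_pos ha h₁ h
      linear_combination mul_pos hcc hd - c p m * c p l * d p (m + l) * hsq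
    · have hd := neg_one_pow_mul_d_pos (q := a + 1) (by omega) h h₂
      linear_combination mul_pos hcc hd + c p m * c p l * d p (m + l) * hsq
end

section
/- Let p ≥ 3 be a natural number and define F₁₂ as in the context. Then for every real t ≥ 0, ∑_{m=p+1}^∞ ∑_{l=p+1}^∞ F₁₂(m,l;t) > 0. -/
/-- The sine factor of `c p (p + a)`, up to sign. -/
noncomputable def sinFactor (p a : ℕ) : ℝ := Real.sin (Real.pi * a / p)

/-- The periodic part of `F12 p (p + a) (p + b) t`. -/
noncomputable def sinProd (p a b : ℕ) : ℝ :=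
  sinFactor p a * sinFactor p b * sinFactor p (a + b)

/-- The positive part of `c p (p + a)`, up to a constant. -/
noncomputable def cWeight (p a : ℕ) : ℝ := 1 / (((p : ℝ) + a) * a * (2 * p + a))

/-- The positive part of `d p (2 * p + n)`, up to a constant. -/
noncomputable def dWeight (p n : ℕ) : ℝ :=
  (1 + (p : ℝ) / (p + n)) / ((3 * (p : ℝ) + n) * n * (4 * p + n))

/-- The exponential factor of `F12 p (p + a) (p + b) t`. -/
noncomputable def expWeight (p : ℕ) (t : ℝ) (a b : ℕ) : ℝ :=
  Real.exp (-(2 * (((p : ℝ) + a) ^ 2 + ((p : ℝ) + b) ^ 2 + ((p : ℝ) + a) * (p + b)) * t))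

/-- The positive part of `F12 p (p + a) (p + b) t`, up to a constant. -/
noncomputable def weight (p : ℕ) (t : ℝ) (a b : ℕ) : ℝ :=
  cWeight p a * cWeight p b * dWeight p (a + b) * expWeight p t a b

theorem c_add_self {p a : ℕ} (hp : 0 < p) (ha : 0 < a) :
    c p (p + a) = 2 * (p : ℝ) ^ 2 / Real.pi * (sinFactor p a * cWeight p a) := by
  have hp' : (0 : ℝ) < p := by exact_mod_cast hp
  have ha' : (0 : ℝ) < a := by exact_mod_cast ha
  have hs : Real.sin (Real.pi * ((p : ℝ) + a) / p) = -sinFactor p a := by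
    rw [sinFactor, ← Real.sin_add_pi]
    congr 1
    field_simp
    ring
  have hd : (p : ℝ) ^ 2 - ((p : ℝ) + a) ^ 2 = -(a * (2 * p + a)) := by ring
  rw [c, if_neg (by omega)]
  push_cast
  rw [hs, hd, cWeight]
  field_simp

theorem d_add_two_mul {p n : ℕ} (hp : 0 < p) (hn : 0 < n) :
    d p (2 * p + n) = 6 * (p : ℝ) ^ 2 / Real.pi * (sinFactor p n * dWeight p n) := by
  have hp' : (0 : ℝ) < p := by exact_mod_cast hp
  have hn' : (0 : ℝ) < n := by exact_mod_cast hn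
  have hs : Real.sin (Real.pi * (2 * (p : ℝ) + n) / p) = sinFactor p n := by
    rw [sinFactor, ← Real.sin_add_two_pi (Real.pi * n / p)]
    congr 1
    field_simp
    ring
  have hd₁ : (p : ℝ) ^ 2 - (2 * (p : ℝ) + n) ^ 2 = -((p + n) * (3 * p + n)) := by ring
  have hd₂ : 4 * (p : ℝ) ^ 2 - (2 * (p : ℝ) + n) ^ 2 = -(n * (4 * p + n)) := by ring
  rw [d, if_neg (by omega)]
  push_cast
  rw [hs, hd₁, hd₂, dWeight]
  field_simp
  ring

theorem F12_add_self {p a b : ℕ} (hp : 0 < p) (ha : 0 < a) (hb : 0 < b) (t : ℝ) :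
    F12 p (p + a) (p + b) t =
      24 * (p : ℝ) ^ 6 / Real.pi ^ 3 * (sinProd p a b * weight p t a b) := by
  have he : Real.exp (-2 * (((p + a : ℕ) : ℝ) ^ 2 + ((p + b : ℕ) : ℝ) ^ 2
      + ((p + a : ℕ) : ℝ) * ((p + b : ℕ) : ℝ)) * t) = expWeight p t a b := by
    rw [expWeight]
    push_cast
    ring_nf
  rw [F12, he, c_add_self hp ha, c_add_self hp hb, show p + a + (p + b) = 2 * p + (a + b) by ring,
    d_add_two_mul hp (by omega), sinProd, weight]
  field_simp
  ring

theorem cWeight_nonneg (p a : ℕ) : 0 ≤ cWeight p a := by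
  unfold cWeight; positivity

theorem cWeight_pos {p a : ℕ} (ha : 0 < a) : 0 < cWeight p a := by
  unfold cWeight; positivity

theorem dWeight_nonneg (p n : ℕ) : 0 ≤ dWeight p n := by
  unfold dWeight; positivity

theorem dWeight_pos {p n : ℕ} (hn : 0 < n) : 0 < dWeight p n := by
  unfold dWeight; positivity

theorem expWeight_pos (p : ℕ) (t : ℝ) (a b : ℕ) : 0 < expWeight p t a b := Real.exp_pos _

theorem cWeight_le {p a a' : ℕ} (ha : 0 < a) (h : a ≤ a') : cWeight p a' ≤ cWeight p a := by
  have h' : (a : ℝ) ≤ a' := by exact_mod_cast h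
  unfold cWeight
  gcongr

theorem cWeight_lt {p a a' : ℕ} (ha : 0 < a) (h : a < a') : cWeight p a' < cWeight p a := by
  have h' : (a : ℝ) < a' := by exact_mod_cast h
  unfold cWeight
  gcongr

theorem dWeight_le {p n n' : ℕ} (hn : 0 < n) (h : n ≤ n') : dWeight p n' ≤ dWeight p n := by
  have h' : (n : ℝ) ≤ n' := by exact_mod_cast h
  unfold dWeight
  gcongr

theorem expWeight_le (p : ℕ) {t : ℝ} (ht : 0 ≤ t) {a a' b b' : ℕ} (h : a ≤ a') (h' : b ≤ b') :
    expWeight p t a' b' ≤ expWeight p t a b := by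
  unfold expWeight
  gcongr

theorem weight_nonneg (p : ℕ) (t : ℝ) (a b : ℕ) : 0 ≤ weight p t a b :=
  mul_nonneg (mul_nonneg (mul_nonneg (cWeight_nonneg _ _) (cWeight_nonneg _ _))
    (dWeight_nonneg _ _)) (expWeight_pos _ _ _ _).le

theorem weight_le {p : ℕ} {t : ℝ} (ht : 0 ≤ t) {a a' b b' : ℕ} (ha : 0 < a) (hb : 0 < b)
    (h : a ≤ a') (h' : b ≤ b') : weight p t a' b' ≤ weight p t a b := by
  have hc : ∀ a b, 0 ≤ cWeight p a * cWeight p b := fun a b =>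
    mul_nonneg (cWeight_nonneg p a) (cWeight_nonneg p b)
  have hcd : ∀ a b, 0 ≤ cWeight p a * cWeight p b * dWeight p (a + b) := fun a b =>
    mul_nonneg (hc a b) (dWeight_nonneg _ _)
  exact mul_le_mul (mul_le_mul
    (mul_le_mul (cWeight_le ha h) (cWeight_le hb h') (cWeight_nonneg _ _) (cWeight_nonneg _ _))
    (dWeight_le (by omega) (by omega)) (dWeight_nonneg _ _) (hc a b))
    (expWeight_le p ht h h') (expWeight_pos _ _ _ _).le (hcd a b)

theorem weight_lt {p : ℕ} {t : ℝ} (ht : 0 ≤ t) {a a' b b' : ℕ} (ha : 0 < a) (hb : 0 < b)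
    (h : a < a') (h' : b ≤ b') : weight p t a' b' < weight p t a b := by
  unfold weight
  have h₁ : cWeight p a' * cWeight p b' < cWeight p a * cWeight p b :=
    mul_lt_mul (cWeight_lt ha h) (cWeight_le hb h') (cWeight_pos (by omega)) (cWeight_nonneg _ _)
  have h₂ := mul_lt_mul h₁ (dWeight_le (p := p) (n := a + b) (n' := a' + b') (by omega) (by omega))
    (dWeight_pos (by omega)) (mul_nonneg (cWeight_nonneg _ _) (cWeight_nonneg _ _))
  exact mul_lt_mul h₂ (expWeight_le p ht h.le h') (expWeight_pos _ _ _ _)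
    (mul_nonneg (mul_nonneg (cWeight_nonneg _ _) (cWeight_nonneg _ _)) (dWeight_nonneg _ _))

theorem sinFactor_mul_add {p : ℕ} (hp : 0 < p) (i r : ℕ) :
    sinFactor p (p * i + r) = (-1) ^ i * sinFactor p r := by
  have hp' : (p : ℝ) ≠ 0 := by positivity
  rw [sinFactor, sinFactor, ← Real.sin_add_nat_mul_pi]
  congr 1
  push_cast
  field_simp
  ring

theorem sinProd_mul_add {p : ℕ} (hp : 0 < p) (i j r s : ℕ) :
    sinProd p (p * i + r) (p * j + s) = sinProd p r s := by
  have h : p * i + r + (p * j + s) = p * (i + j) + (r + s) := by ring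
  have hsq : ((-1 : ℝ) ^ i * (-1) ^ j) ^ 2 = 1 := by
    rw [← pow_add, ← pow_mul, mul_comm, pow_mul]; simp
  rw [sinProd, h, sinFactor_mul_add hp, sinFactor_mul_add hp, sinFactor_mul_add hp, sinProd,
    pow_add]
  linear_combination (sinFactor p r * sinFactor p s * sinFactor p (r + s)) * hsq

theorem sinProd_reflect {p r s : ℕ} (hp : 0 < p) (hr : r ≤ p) (hs : s ≤ p) :
    sinProd p (p - s) (p - r) = -sinProd p r s := by
  have hp' : (p : ℝ) ≠ 0 := by positivity
  have key : ∀ x ≤ p, sinFactor p (p - x) = sinFactor p x := by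
    intro x hx
    rw [sinFactor, sinFactor, ← Real.sin_pi_sub]
    congr 1
    rw [Nat.cast_sub hx]
    field_simp
    ring
  have h : sinFactor p (p - s + (p - r)) = -sinFactor p (r + s) := by
    rw [sinFactor, sinFactor, ← Real.sin_two_pi_sub]
    congr 1
    push_cast [Nat.cast_sub hr, Nat.cast_sub hs]
    field_simp
    ring
  rw [sinProd, key s hs, key r hr, h, sinProd]
  ring

theorem sinFactor_pos {p r : ℕ} (hr : 0 < r) (hrp : r < p) : 0 < sinFactor p r := by
  have hp : (0 : ℝ) < p := by exact_mod_cast hr.trans hrp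
  have hr' : (0 : ℝ) < r := by exact_mod_cast hr
  have hrp' : (r : ℝ) < p := by exact_mod_cast hrp
  apply Real.sin_pos_of_pos_of_lt_pi (by positivity)
  rw [div_lt_iff₀ hp]
  exact mul_lt_mul_of_pos_left hrp' Real.pi_pos

theorem sinProd_pos {p r s : ℕ} (hr : 0 < r) (hs : 0 < s) (h : r + s < p) :
    0 < sinProd p r s :=
  mul_pos (mul_pos (sinFactor_pos hr (by omega)) (sinFactor_pos hs (by omega)))
    (sinFactor_pos (by omega) h)

theorem sinProd_nonpos {p r s : ℕ} (hr : r < p) (hs : s < p) (h : p ≤ r + s) :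
    sinProd p r s ≤ 0 := by
  rcases h.eq_or_lt with h | h
  · have : sinFactor p p = 0 := by
      have hp' : (p : ℝ) ≠ 0 := by exact_mod_cast (by omega : p ≠ 0)
      rw [sinFactor, mul_div_assoc, div_self hp', mul_one, Real.sin_pi]
    rw [sinProd, ← h, this, mul_zero]
  · rw [← neg_nonneg, ← sinProd_reflect (by omega) hr.le hs.le]
    exact (sinProd_pos (by omega) (by omega) (by omega)).le

theorem sinProd_eq_zero_of_mod {p a b : ℕ} (hp : 0 < p) (h : a % p = 0 ∨ b % p = 0) :
    sinProd p a b = 0 := by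
  rw [← Nat.div_add_mod a p, ← Nat.div_add_mod b p, sinProd_mul_add hp]
  rcases h with h | h <;> simp [h, sinProd, sinFactor]

/-- In each `p × p` block, the reflection in the antidiagonal; pairs with a coordinate divisible
by `p` are fixed. -/
def blockReflect (p : ℕ) (x : ℕ × ℕ) : ℕ × ℕ :=
  if x.1 % p = 0 ∨ x.2 % p = 0 then x
  else (p * (x.1 / p) + (p - x.2 % p), p * (x.2 / p) + (p - x.1 % p))

theorem blockReflect_mul_add {p r s : ℕ} (i j : ℕ) (hr : 0 < r) (hs : 0 < s) (hrp : r < p)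
    (hsp : s < p) :
    blockReflect p (p * i + r, p * j + s) = (p * i + (p - s), p * j + (p - r)) := by
  have hp : 0 < p := by omega
  simp [blockReflect, Nat.mul_add_div hp, Nat.mod_eq_of_lt hrp,
    Nat.mod_eq_of_lt hsp, Nat.div_eq_of_lt hrp, Nat.div_eq_of_lt hsp, hr.ne', hs.ne']

/-- A pair is either fixed by `blockReflect` or has explicit nonzero residues. -/
theorem exists_block {p : ℕ} (hp : 0 < p) (x : ℕ × ℕ) :
    (x.1 % p = 0 ∨ x.2 % p = 0) ∨ ∃ i j r s, 0 < r ∧ 0 < s ∧ r < p ∧ s < p ∧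
      x = (p * i + r, p * j + s) := by
  by_cases h : x.1 % p = 0 ∨ x.2 % p = 0
  · exact .inl h
  · push Not at h
    exact .inr ⟨x.1 / p, x.2 / p, x.1 % p, x.2 % p, Nat.pos_of_ne_zero h.1, Nat.pos_of_ne_zero h.2,
      Nat.mod_lt _ hp, Nat.mod_lt _ hp, by rw [Nat.div_add_mod, Nat.div_add_mod]⟩

theorem blockReflect_involutive {p : ℕ} (hp : 0 < p) : Function.Involutive (blockReflect p) := by
  intro x
  rcases exists_block hp x with h | ⟨i, j, r, s, hr, hs, hrp, hsp, rfl⟩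
  · simp [blockReflect, h]
  · rw [blockReflect_mul_add i j hr hs hrp hsp,
      blockReflect_mul_add i j (by omega) (by omega) (by omega) (by omega),
      Nat.sub_sub_self hrp.le, Nat.sub_sub_self hsp.le]

/-- `F12 p (p + a) (p + b) t` up to a constant, as a function on pairs vanishing on the axes. -/
noncomputable def tailTerm (p : ℕ) (t : ℝ) (x : ℕ × ℕ) : ℝ :=
  sinProd p x.1 x.2 * weight p t x.1 x.2

theorem tailTerm_add_blockReflect {p r s : ℕ} (t : ℝ) (i j : ℕ) (hr : 0 < r) (hs : 0 < s)
    (hrp : r < p) (hsp : s < p) :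
    tailTerm p t (p * i + r, p * j + s) + tailTerm p t (blockReflect p (p * i + r, p * j + s)) =
      sinProd p r s *
        (weight p t (p * i + r) (p * j + s) - weight p t (p * i + (p - s)) (p * j + (p - r))) := by
  have hp : 0 < p := by omega
  rw [blockReflect_mul_add i j hr hs hrp hsp]
  simp only [tailTerm]
  rw [sinProd_mul_add hp, sinProd_mul_add hp, sinProd_reflect hp hrp.le hsp.le]
  ring

theorem tailTerm_add_blockReflect_nonneg {p : ℕ} (hp : 0 < p) {t : ℝ} (ht : 0 ≤ t) (x : ℕ × ℕ) :
    0 ≤ tailTerm p t x + tailTerm p t (blockReflect p x) := by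
  rcases exists_block hp x with h | ⟨i, j, r, s, hr, hs, hrp, hsp, rfl⟩
  · simp [blockReflect, h, tailTerm, sinProd_eq_zero_of_mod hp h]
  · rw [tailTerm_add_blockReflect t i j hr hs hrp hsp]
    rcases lt_or_ge (r + s) p with h | h
    · exact mul_nonneg (sinProd_pos hr hs h).le (sub_nonneg.2
        (weight_le ht (by omega) (by omega) (by omega) (by omega)))
    · exact mul_nonneg_of_nonpos_of_nonpos (sinProd_nonpos hrp hsp h) (sub_nonpos.2
        (weight_le ht (by omega) (by omega) (by omega) (by omega)))

theorem tailTerm_add_blockReflect_one_one_pos {p : ℕ} (hp : 3 ≤ p) {t : ℝ} (ht : 0 ≤ t) :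
    0 < tailTerm p t (1, 1) + tailTerm p t (blockReflect p (1, 1)) := by
  have h := tailTerm_add_blockReflect (p := p) (r := 1) (s := 1) t 0 0 one_pos one_pos
    (by omega) (by omega)
  simp only [mul_zero, zero_add] at h
  rw [h]
  exact mul_pos (sinProd_pos one_pos one_pos (by omega))
    (sub_pos.2 (weight_lt ht one_pos one_pos (by omega) (by omega)))

theorem abs_sinProd_le_one (p a b : ℕ) : |sinProd p a b| ≤ 1 := by
  rw [sinProd, abs_mul, abs_mul]
  exact mul_le_one₀ (mul_le_one₀ (Real.abs_sin_le_one _) (abs_nonneg _) (Real.abs_sin_le_one _))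
    (abs_nonneg _) (Real.abs_sin_le_one _)

theorem cWeight_le_one_div_sq {p a : ℕ} (hp : 0 < p) : cWeight p a ≤ 1 / (a : ℝ) ^ 2 := by
  rcases a.eq_zero_or_pos with rfl | ha
  · simp [cWeight]
  · have hp' : (1 : ℝ) ≤ p := by exact_mod_cast hp
    have ha' : (0 : ℝ) < a := by exact_mod_cast ha
    unfold cWeight
    apply one_div_le_one_div_of_le (by positivity)
    have h : (1 : ℝ) ≤ p + a := by linarith
    calc (a : ℝ) ^ 2 ≤ 1 * a * (2 * p + a) := by nlinarith
      _ ≤ _ := by gcongr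

theorem dWeight_le_one {p n : ℕ} (hp : 0 < p) : dWeight p n ≤ 1 := by
  rcases n.eq_zero_or_pos with rfl | hn
  · simp [dWeight]
  · have hp' : (1 : ℝ) ≤ p := by exact_mod_cast hp
    have hn' : (1 : ℝ) ≤ n := by exact_mod_cast hn
    unfold dWeight
    have h₁ : (p : ℝ) / (p + n) ≤ 1 := div_le_one_of_le₀ (by linarith) (by linarith)
    apply div_le_one_of_le₀ _ (by positivity)
    have h₂ : (3 : ℝ) ≤ (3 * p + n) * n := by nlinarith
    nlinarith

theorem weight_le_mul {p : ℕ} (hp : 0 < p) {t : ℝ} (ht : 0 ≤ t) (a b : ℕ) :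
    weight p t a b ≤ 1 / (a : ℝ) ^ 2 * (1 / (b : ℝ) ^ 2) := by
  have he : expWeight p t a b ≤ 1 := Real.exp_le_one_iff.2 (by rw [neg_nonpos]; positivity)
  have hc := mul_nonneg (cWeight_nonneg p a) (cWeight_nonneg p b)
  calc weight p t a b ≤ cWeight p a * cWeight p b * dWeight p (a + b) :=
        mul_le_of_le_one_right (mul_nonneg hc (dWeight_nonneg _ _)) he
    _ ≤ cWeight p a * cWeight p b := mul_le_of_le_one_right hc (dWeight_le_one hp)
    _ ≤ _ := mul_le_mul (cWeight_le_one_div_sq hp) (cWeight_le_one_div_sq hp)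
      (cWeight_nonneg _ _) (by positivity)

theorem summable_tailTerm {p : ℕ} (hp : 0 < p) {t : ℝ} (ht : 0 ≤ t) :
    Summable (tailTerm p t) := by
  have h : Summable fun n : ℕ => 1 / (n : ℝ) ^ 2 := Real.summable_one_div_nat_pow.2 one_lt_two
  refine Summable.of_norm_bounded
    (h.mul_of_nonneg h (fun _ => by positivity) fun _ => by positivity) fun x => ?_
  rw [Real.norm_eq_abs, tailTerm, abs_mul, abs_of_nonneg (weight_nonneg _ _ _ _)]
  exact (mul_le_of_le_one_left (weight_nonneg _ _ _ _) (abs_sinProd_le_one _ _ _)).trans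
    (weight_le_mul hp ht _ _)

theorem tsum_tailTerm_pos {p : ℕ} (hp : 3 ≤ p) {t : ℝ} (ht : 0 ≤ t) :
    0 < ∑' x, tailTerm p t x := by
  have hp' : 0 < p := by omega
  let e := (blockReflect_involutive hp').toPerm
  have hs := summable_tailTerm hp' ht
  have hse : Summable fun x => tailTerm p t (e x) := e.summable_iff.2 hs
  have hpos : 0 < ∑' x, (tailTerm p t x + tailTerm p t (e x)) :=
    (hs.add hse).tsum_pos (tailTerm_add_blockReflect_nonneg hp' ht) (1, 1)
      (tailTerm_add_blockReflect_one_one_pos hp ht)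
  rw [hs.tsum_add hse, e.tsum_eq] at hpos
  linarith

theorem J12_tail_pos (p : ℕ) (hp : 3 ≤ p) (t : ℝ) (ht : 0 ≤ t) :
    0 < ∑' m : ℕ, ∑' l : ℕ, F12 p (p + 1 + m) (p + 1 + l) t := by
  have hp' : 0 < p := by omega
  let shift : ℕ × ℕ → ℕ × ℕ := Prod.map (1 + ·) (1 + ·)
  have hinj : Function.Injective shift :=
    (add_right_injective 1).prodMap (add_right_injective 1)
  have hsupp : Function.support (tailTerm p t) ⊆ Set.range shift := by
    rintro ⟨a, b⟩ hx
    have ha : a ≠ 0 := by rintro rfl; simp [tailTerm, sinProd, sinFactor] at hx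
    have hb : b ≠ 0 := by rintro rfl; simp [tailTerm, sinProd, sinFactor] at hx
    exact ⟨(a - 1, b - 1), by simp only [shift, Prod.map_apply, Prod.mk.injEq]; omega⟩
  have hs : Summable fun x => tailTerm p t (shift x) :=
    (summable_tailTerm hp' ht).comp_injective hinj
  have hF : ∀ m l : ℕ, F12 p (p + 1 + m) (p + 1 + l) t =
      24 * (p : ℝ) ^ 6 / Real.pi ^ 3 * tailTerm p t (shift (m, l)) := fun m l => by
    rw [add_assoc, add_assoc, F12_add_self hp' (by omega) (by omega)]
    rfl
  simp_rw [hF, tsum_mul_left]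
  rw [← hs.tsum_prod, hinj.tsum_eq hsupp]
  exact mul_pos (by positivity) (tsum_tailTerm_pos hp ht)
end

section
/- Let p ≥ 3 be a natural number and define F₁₂ as in the context. Then for every real t ≥ 0, (3/10)·∑_{m,l ≥ 1, m+l < p} F₁₂(p+m, l; t) + ∑_{a=2}^∞ ∑_{m,l ≥ 1, m+l < p} F₁₂(pa+m, l; t) > 0, where the inner sums run over pairs of positive integers (m,l) with m + l < p. -/
/-- The rational profile of `c` in the rescaled variable `u = k / p`. -/
noncomputable def cProfile (u : ℝ) : ℝ := 1 / ((u - 1) * u * (u + 1))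

/-- The rational profile of `d` in the rescaled variable `v = k / p`. -/
noncomputable def dProfile (v : ℝ) : ℝ := v / ((v ^ 2 - 1) * (v ^ 2 - 4))

theorem sin_pi_mul_shift_div {p : ℕ} (hp : 0 < p) (a m : ℕ) :
    Real.sin (Real.pi * ((p * a + m : ℕ) : ℝ) / p) =
      (-1) ^ a * Real.sin (Real.pi * m / p) := by
  have hP : (p : ℝ) ≠ 0 := by positivity
  rw [← Real.sin_add_nat_mul_pi]
  congr 1
  push_cast
  field_simp
  ring

theorem c_shift {p m : ℕ} (a : ℕ) (hm : 0 < m) (hmp : m < p) (ha : 1 ≤ a) :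
    c p (p * a + m) = (-1) ^ (a + 1) *
      (2 * Real.sin (Real.pi * m / p) / (Real.pi * p)) * cProfile (a + m / p) := by
  have hp : 0 < p := by omega
  have hP : (0 : ℝ) < p := by positivity
  have hM : (0 : ℝ) < m := by positivity
  have hA : (1 : ℝ) ≤ a := by exact_mod_cast ha
  have hK : (p : ℝ) < p * a + m := by nlinarith
  have hne : p * a + m ≠ p := by
    intro h
    have : ((p * a + m : ℕ) : ℝ) = p := by exact_mod_cast h
    push_cast at this
    linarith
  obtain ⟨K, hKdef⟩ : ∃ K : ℝ, K = p * a + m := ⟨_, rfl⟩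
  have hu : (a : ℝ) + m / p = K / p := by rw [hKdef]; field_simp
  rw [c, if_neg hne, sin_pi_mul_shift_div hp, cProfile, hu, pow_succ (-1 : ℝ) a]
  push_cast
  rw [← hKdef] at hK ⊢
  have h0 : K ≠ 0 := by linarith
  have h1 : K - p ≠ 0 := by linarith
  have h2 : K + p ≠ 0 := by linarith
  have e1 : (p : ℝ) ^ 2 - K ^ 2 = -((K - p) * (K + p)) := by ring
  have e2 : (K / p - 1) * (K / p) * (K / p + 1) = (K - p) * K * (K + p) / (p : ℝ) ^ 3 := by
    field_simp
  rw [e1, e2]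
  field_simp

theorem d_shift {p s : ℕ} (a : ℕ) (hs : 0 < s) (hsp : s < p) (ha : 1 ≤ a) :
    d p (p * a + s) = (-1) ^ a *
      (6 * Real.sin (Real.pi * s / p) / (Real.pi * p)) * dProfile (a + s / p) := by
  have hp : 0 < p := by omega
  have hP : (0 : ℝ) < p := by positivity
  have hlt : p < p * a + s := by nlinarith
  have hne2 : p * a + s ≠ 2 * p := by
    rcases Nat.lt_or_ge a 2 with h | h
    · obtain rfl : a = 1 := by omega
      omega
    · nlinarith
  have hK : (p : ℝ) < p * a + s := by exact_mod_cast hlt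
  have hK2 : (p * a + s : ℝ) ≠ 2 * p := by exact_mod_cast hne2
  obtain ⟨K, hKdef⟩ : ∃ K : ℝ, K = p * a + s := ⟨_, rfl⟩
  have hu : (a : ℝ) + s / p = K / p := by rw [hKdef]; field_simp
  rw [d, if_neg (by omega), sin_pi_mul_shift_div hp, dProfile, hu]
  push_cast
  rw [← hKdef] at hK hK2 ⊢
  have h1 : (p : ℝ) ^ 2 - K ^ 2 ≠ 0 := by nlinarith
  have h2 : 4 * (p : ℝ) ^ 2 - K ^ 2 ≠ 0 := by
    have : (2 * p - K) * (2 * p + K) ≠ 0 :=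
      mul_ne_zero (sub_ne_zero.2 hK2.symm) (by linarith)
    intro h
    exact this (by linarith)
  have e1 : ((K / p) ^ 2 - 1) * ((K / p) ^ 2 - 4) =
      ((p : ℝ) ^ 2 - K ^ 2) * (4 * (p : ℝ) ^ 2 - K ^ 2) / (p : ℝ) ^ 4 := by
    field_simp
    ring
  rw [e1]
  field_simp

theorem cProfile_pos {u : ℝ} (hu : 1 < u) : 0 < cProfile u := by
  have : 0 < u - 1 := by linarith
  unfold cProfile
  positivity

theorem cProfile_le_cProfile {u w : ℝ} (hu : 1 < u) (huw : u ≤ w) :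
    cProfile w ≤ cProfile u := by
  have hu1 : 0 < u - 1 := by linarith
  have hw1 : 0 ≤ w - 1 := by linarith
  have hw : 0 ≤ (w - 1) * w := mul_nonneg (by linarith) (by linarith)
  unfold cProfile
  gcongr

theorem dProfile_pos {v : ℝ} (hv : 2 < v) : 0 < dProfile v := by
  have h1 : 0 < v ^ 2 - 1 := by nlinarith
  have h4 : 0 < v ^ 2 - 4 := by nlinarith
  unfold dProfile
  positivity

theorem dProfile_neg {v : ℝ} (h1 : 1 < v) (h2 : v < 2) : dProfile v < 0 :=
  div_neg_of_pos_of_neg (by linarith) (mul_neg_of_pos_of_neg (by nlinarith) (by nlinarith))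

theorem dProfile_le_dProfile {v w : ℝ} (hv : 2 < v) (hvw : v ≤ w) :
    dProfile w ≤ dProfile v := by
  have hv1 : 0 < v ^ 2 - 1 := by nlinarith
  have hv4 : 0 < v ^ 2 - 4 := by nlinarith
  have hw4 : 0 < w ^ 2 - 4 := by nlinarith
  have key : w / (w ^ 2 - 4) ≤ v / (v ^ 2 - 4) := by
    rw [div_le_div_iff₀ hw4 hv4]
    nlinarith [mul_nonneg (sub_nonneg.2 hvw) (show 0 ≤ v * w + 4 by nlinarith)]
  have hinv : 1 / (w ^ 2 - 1) ≤ 1 / (v ^ 2 - 1) := by gcongr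
  have split (z : ℝ) : dProfile z = 1 / (z ^ 2 - 1) * (z / (z ^ 2 - 4)) := by
    rw [dProfile, div_mul_div_comm, one_mul]
  rw [split, split]
  exact mul_le_mul hinv key (div_nonneg (by linarith) hw4.le) (by positivity)

theorem dProfile_two_add_le {σ : ℝ} (h0 : 0 < σ) (h1 : σ < 1) :
    dProfile (2 + σ) ≤ cProfile (1 + σ) * -dProfile (1 + σ) := by
  have hσ : 0 < 1 - σ := by linarith
  have e2 : dProfile (2 + σ) = (2 + σ) / ((1 + σ) * (3 + σ) * σ * (4 + σ)) := by
    unfold dProfile; congr 1; ring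
  have e1 : cProfile (1 + σ) * -dProfile (1 + σ) =
      1 / (σ * (2 + σ) * (σ * (2 + σ) * (1 - σ) * (3 + σ))) := by
    have : ((1 + σ) ^ 2 - 1) * ((1 + σ) ^ 2 - 4) = -(σ * (2 + σ) * (1 - σ) * (3 + σ)) := by ring
    rw [cProfile, dProfile, this, div_neg, neg_neg]
    have : 1 + σ - 1 = σ := by ring
    rw [this]
    field_simp
    ring
  rw [e1, e2, div_le_div_iff₀ (by positivity) (by positivity)]
  have key : σ * (1 - σ) * (2 + σ) ^ 3 ≤ (1 + σ) * (4 + σ) := by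
    have hq : σ * (1 - σ) ≤ 1 / 4 := by nlinarith [sq_nonneg (σ - 1 / 2)]
    have hc : (2 + σ) ^ 3 ≤ 4 * ((1 + σ) * (4 + σ)) := by
      nlinarith [mul_pos h0 hσ, mul_pos (mul_pos h0 hσ) h0]
    nlinarith [mul_le_mul_of_nonneg_right hq (show 0 ≤ (2 + σ) ^ 3 by positivity)]
  have := mul_le_mul_of_nonneg_left key (show 0 ≤ σ * (3 + σ) by positivity)
  linarith

theorem profile_mul_le {x σ : ℝ} (hx : 0 < x) (hxσ : x ≤ σ) (hσ : σ < 1) (n : ℕ) :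
    cProfile (n + 2 + x) * dProfile (n + 2 + σ) ≤
      cProfile (1 + x) * -dProfile (1 + σ) * cProfile (n + 2) := by
  have hn : (0 : ℝ) ≤ n := n.cast_nonneg
  have hneg : 0 ≤ -dProfile (1 + σ) := by
    linarith [dProfile_neg (v := 1 + σ) (by linarith) (by linarith)]
  rw [mul_comm]
  refine mul_le_mul ?_ (cProfile_le_cProfile (by linarith) (by linarith))
    (cProfile_pos (by linarith)).le
    (mul_nonneg (cProfile_pos (by linarith)).le hneg)
  calc dProfile (n + 2 + σ) ≤ dProfile (2 + σ) :=
        dProfile_le_dProfile (by linarith) (by linarith)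
    _ ≤ cProfile (1 + σ) * -dProfile (1 + σ) := dProfile_two_add_le (by linarith) hσ
    _ ≤ cProfile (1 + x) * -dProfile (1 + σ) :=
        mul_le_mul_of_nonneg_right (cProfile_le_cProfile (by linarith) (by linarith)) hneg

theorem sum_range_cProfile (N : ℕ) :
    ∑ n ∈ Finset.range N, cProfile (n + 2) =
      1 / 4 - 1 / (2 * ((N : ℝ) + 1) * (N + 2)) := by
  induction N with
  | zero => norm_num
  | succ N ih =>
    rw [Finset.sum_range_succ, ih, cProfile]
    have : (N : ℝ) + 2 - 1 = N + 1 := by ring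
    rw [this]
    push_cast
    field_simp
    ring

theorem sum_range_cProfile_le (N : ℕ) :
    ∑ n ∈ Finset.range N, cProfile (n + 2) ≤ 1 / 4 := by
  rw [sum_range_cProfile]
  have : 0 ≤ 1 / (2 * ((N : ℝ) + 1) * (N + 2)) := by positivity
  linarith

theorem sin_pi_mul_div_pos_s6 {p m : ℕ} (hm : 0 < m) (hmp : m < p) :
    0 < Real.sin (Real.pi * m / p) := by
  have hM : (0 : ℝ) < m := by positivity
  have hMP : (m : ℝ) < p := by exact_mod_cast hmp
  have hP : (0 : ℝ) < p := hM.trans hMP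
  apply Real.sin_pos_of_pos_of_lt_pi
  · positivity
  · rw [div_lt_iff₀ hP]
    exact mul_lt_mul_of_pos_left hMP Real.pi_pos

theorem c_pos_s6 {p l : ℕ} (hl : 0 < l) (hlp : l < p) : 0 < c p l := by
  rw [c, if_neg hlp.ne]
  have hLP : (l : ℝ) < p := by exact_mod_cast hlp
  have hL : (0 : ℝ) < l := by positivity
  have := sin_pi_mul_div_pos_s6 hl hlp
  have : 0 < (p : ℝ) ^ 2 - (l : ℝ) ^ 2 := by nlinarith
  have : (0 : ℝ) < p := by linarith
  positivity

/-- The strip terms factor through the profiles, with a positive prefactor independent of `a`. -/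
theorem exists_F12_shift_eq {p m l : ℕ} (hm : 0 < m) (hl : 0 < l) (hml : m + l < p) :
    ∃ C : ℝ, 0 < C ∧ ∀ (a : ℕ) (t : ℝ), 1 ≤ a → F12 p (p * a + m) l t =
      -(C * (cProfile (a + m / p) * dProfile (a + (m + l) / p)) *
        Real.exp (-2 * (((p * a + m : ℕ) : ℝ) ^ 2 + (l : ℝ) ^ 2 +
          ((p * a + m : ℕ) : ℝ) * (l : ℝ)) * t)) := by
  have h1 := sin_pi_mul_div_pos_s6 hm (show m < p by omega)
  have h2 := sin_pi_mul_div_pos_s6 (show 0 < m + l by omega) hml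
  have h3 := c_pos_s6 hl (show l < p by omega)
  have hP : (0 : ℝ) < p := by exact_mod_cast (show 0 < p by omega)
  refine ⟨(2 * Real.sin (Real.pi * m / p) / (Real.pi * p)) * c p l *
    (6 * Real.sin (Real.pi * (m + l : ℕ) / p) / (Real.pi * p)), by positivity, ?_⟩
  intro a t ha
  rw [F12, c_shift a hm (by omega) ha, add_assoc, d_shift a (by omega) hml ha]
  have hsq : ((-1 : ℝ) ^ a) * (-1) ^ a = 1 := by rw [← mul_pow]; norm_num
  rw [pow_succ]
  push_cast
  linear_combination (-(2 * Real.sin (Real.pi * m / p) / (Real.pi * p)) * c p l *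
    (6 * Real.sin (Real.pi * (m + l) / p) / (Real.pi * p)) *
    (cProfile (a + m / p) * dProfile (a + (m + l) / p)) *
    Real.exp (-2 * (((p : ℝ) * a + m) ^ 2 + (l : ℝ) ^ 2 + ((p : ℝ) * a + m) * (l : ℝ)) * t)) * hsq

theorem F12_first_strip_pos {p m l : ℕ} (hm : 0 < m) (hl : 0 < l) (hml : m + l < p) (t : ℝ) :
    0 < F12 p (p + m) l t := by
  obtain ⟨C, hC, hF⟩ := exists_F12_shift_eq hm hl hml
  have hP : (0 : ℝ) < p := by exact_mod_cast (show 0 < p by omega)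
  have hML : (m : ℝ) + l < p := by exact_mod_cast hml
  have hσ : ((m : ℝ) + l) / p < 1 := (div_lt_one hP).2 hML
  have hσ0 : 0 < ((m : ℝ) + l) / p := by positivity
  have hx0 : 0 < (m : ℝ) / p := by positivity
  have h1 := hF 1 t le_rfl
  rw [mul_one, Nat.cast_one] at h1
  rw [h1, neg_pos]
  exact mul_neg_of_neg_of_pos (mul_neg_of_pos_of_neg hC (mul_neg_of_pos_of_neg
    (cProfile_pos (by linarith)) (dProfile_neg (by linarith) (by linarith)))) (Real.exp_pos _)

theorem abs_F12_shift_le {p m l : ℕ} (hm : 0 < m) (hl : 0 < l) (hml : m + l < p)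
    {t : ℝ} (ht : 0 ≤ t) (n : ℕ) :
    |F12 p (p * (n + 2) + m) l t| ≤ F12 p (p + m) l t * cProfile (n + 2) := by
  obtain ⟨C, hC, hF⟩ := exists_F12_shift_eq hm hl hml
  have hP : (0 : ℝ) < p := by exact_mod_cast (show 0 < p by omega)
  have hML : (m : ℝ) + l < p := by exact_mod_cast hml
  have hσ : ((m : ℝ) + l) / p < 1 := (div_lt_one hP).2 hML
  have hσ0 : 0 < ((m : ℝ) + l) / p := by positivity
  have hx0 : 0 < (m : ℝ) / p := by positivity
  have hxσ : (m : ℝ) / p ≤ (m + l) / p := by gcongr; linarith [l.cast_nonneg (α := ℝ)]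
  have hn : (0 : ℝ) ≤ n := n.cast_nonneg
  have h1 := hF 1 t le_rfl
  rw [mul_one, Nat.cast_one] at h1
  rw [h1, hF (n + 2) t (by omega), abs_neg]
  have hle : p + m ≤ p * (n + 2) + m := by nlinarith
  have hpos : 0 < cProfile ((n : ℝ) + 2 + m / p) * dProfile (n + 2 + (m + l) / p) :=
    mul_pos (cProfile_pos (by linarith)) (dProfile_pos (by linarith))
  have hprof := profile_mul_le hx0 hxσ hσ n
  rw [Nat.cast_add n 2, Nat.cast_ofNat, abs_of_pos (by positivity)]
  have hexp : Real.exp (-2 * (((p * (n + 2) + m : ℕ) : ℝ) ^ 2 + (l : ℝ) ^ 2 +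
        ((p * (n + 2) + m : ℕ) : ℝ) * (l : ℝ)) * t) ≤
      Real.exp (-2 * (((p + m : ℕ) : ℝ) ^ 2 + (l : ℝ) ^ 2 + ((p + m : ℕ) : ℝ) * (l : ℝ)) * t) := by
    have hcast : ((p + m : ℕ) : ℝ) ≤ ((p * (n + 2) + m : ℕ) : ℝ) := by exact_mod_cast hle
    have : ((p + m : ℕ) : ℝ) ^ 2 + (l : ℝ) ^ 2 + ((p + m : ℕ) : ℝ) * l ≤
      ((p * (n + 2) + m : ℕ) : ℝ) ^ 2 + (l : ℝ) ^ 2 + ((p * (n + 2) + m : ℕ) : ℝ) * l := by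
      gcongr
    rw [Real.exp_le_exp]
    nlinarith [mul_le_mul_of_nonneg_right this ht]
  have := mul_le_mul (mul_le_mul_of_nonneg_left hprof hC.le) hexp (Real.exp_pos _).le
    (mul_nonneg hC.le (hpos.le.trans hprof))
  linarith

theorem J12_strip_pos (p : ℕ) (hp : 3 ≤ p) (t : ℝ) (ht : 0 ≤ t) :
    0 < (3 / 10) * (∑ m ∈ Finset.Ico 1 p, ∑ l ∈ Finset.Ico 1 p,
          if m + l < p then F12 p (p + m) l t else 0)
      + ∑' a : ℕ, (∑ m ∈ Finset.Ico 1 p, ∑ l ∈ Finset.Ico 1 p,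
          if m + l < p then F12 p (p * (a + 2) + m) l t else 0) := by
  set A := ∑ m ∈ Finset.Ico 1 p, ∑ l ∈ Finset.Ico 1 p,
    if m + l < p then F12 p (p + m) l t else 0 with hA
  set G : ℕ → ℝ := fun a => ∑ m ∈ Finset.Ico 1 p, ∑ l ∈ Finset.Ico 1 p,
    if m + l < p then F12 p (p * (a + 2) + m) l t else 0 with hG
  have hterm : ∀ m ∈ Finset.Ico 1 p, ∀ l ∈ Finset.Ico 1 p,
      0 ≤ if m + l < p then F12 p (p + m) l t else 0 := by
    intro m hm l hl
    rw [Finset.mem_Ico] at hm hl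
    split_ifs with h
    · exact (F12_first_strip_pos (by omega) (by omega) h t).le
    · exact le_rfl
  have hApos : 0 < A := by
    have h1 : 1 ∈ Finset.Ico 1 p := Finset.mem_Ico.2 (by omega)
    refine Finset.sum_pos' (fun m hm => Finset.sum_nonneg (hterm m hm)) ⟨1, h1, ?_⟩
    refine Finset.sum_pos' (hterm 1 h1) ⟨1, h1, ?_⟩
    rw [if_pos (by omega)]
    exact F12_first_strip_pos one_pos one_pos (by omega) t
  have hbound (n : ℕ) : |G n| ≤ A * cProfile (n + 2) := by
    rw [hA, Finset.sum_mul]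
    refine (Finset.abs_sum_le_sum_abs _ _).trans (Finset.sum_le_sum fun m hm => ?_)
    rw [Finset.sum_mul]
    refine (Finset.abs_sum_le_sum_abs _ _).trans (Finset.sum_le_sum fun l hl => ?_)
    rw [Finset.mem_Ico] at hm hl
    split_ifs with h
    · exact abs_F12_shift_le (by omega) (by omega) h ht n
    · simp
  have hnonneg (n : ℕ) : 0 ≤ cProfile (n + 2) :=
    (cProfile_pos (by linarith [n.cast_nonneg (α := ℝ)])).le
  have hsum : Summable fun n : ℕ => cProfile (n + 2) :=
    summable_of_sum_range_le hnonneg sum_range_cProfile_le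
  have htsum : ∑' n : ℕ, cProfile (n + 2) ≤ 1 / 4 :=
    Real.tsum_le_of_sum_range_le hnonneg sum_range_cProfile_le
  have habs : ‖∑' n, G n‖ ≤ A * ∑' n : ℕ, cProfile (n + 2) := by
    rw [← tsum_mul_left]
    exact tsum_of_norm_bounded (hsum.mul_left A).hasSum hbound
  have := neg_le_of_abs_le habs
  nlinarith
end
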